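/- arXiv:2104.05056 — 2 statements merged into one kernel-verified Lean document; each statement's English description precedes it below -/
import Mathlib

section
/- Let Ω ⊂ P(ℝ^d) be a properly convex domain with Hilbert metric d_Ω and let S ⊂ Ω be a properly embedded simplex with vertices v₁,…,v_p. If w_j ∈ F_Ω(v_j) for each 1 ≤ j ≤ p, then S′ := Ω ∩ P(span{w₁,…,w_p}), which equals the relative interior of the convex hull of w₁,…,w_p, is a properly embedded simplex in Ω with vertices w₁,…,w_p; moreover the Hausdorff distance, with respect to d_Ω, between S and S′ is at most max_{1≤j≤p} d_{F_Ω(v_j)}(v_j, w_j). -/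
open Set Filter

noncomputable section

/-- Real projective space `P(ℝ^d)`, with the quotient topology. -/
abbrev PSpace (d : ℕ) := Projectivization ℝ (Fin d → ℝ)

instance PSpace.instTopologicalSpace (d : ℕ) : TopologicalSpace (PSpace d) :=
  inferInstanceAs (TopologicalSpace (Quotient (projectivizationSetoid ℝ (Fin d → ℝ))))

namespace Paper

variable {d : ℕ}

/-- Inhomogeneous coordinates in the affine chart determined by the linear functional `f`:
a projective point `[v]` with `f v ≠ 0` is sent to the representative `v / f v` lying in the
affine hyperplane `{f = 1}`. -/
def chartMap (f : (Fin d → ℝ) →ₗ[ℝ] ℝ) (x : PSpace d) : Fin d → ℝ :=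
  (f x.rep)⁻¹ • x.rep

/-- A subset of `P(ℝ^d)` is properly convex if there is an affine chart in which it is a
bounded convex set. -/
def IsProperlyConvex (C : Set (PSpace d)) : Prop :=
  ∃ f : (Fin d → ℝ) →ₗ[ℝ] ℝ, (∀ x ∈ closure C, f x.rep ≠ 0) ∧
    Convex ℝ (chartMap f '' C) ∧ Bornology.IsBounded (chartMap f '' C)

/-- A properly convex domain: an open, nonempty, properly convex subset of `P(ℝ^d)`. -/
def IsPCDomain (Ω : Set (PSpace d)) : Prop :=
  IsOpen Ω ∧ Ω.Nonempty ∧ IsProperlyConvex Ω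

open Classical in
/-- A choice of an affine chart containing the properly convex set `C`. -/
def chartOf (C : Set (PSpace d)) : (Fin d → ℝ) →ₗ[ℝ] ℝ :=
  if h : IsProperlyConvex C then h.choose else 0

/-- The chart map associated to the chosen chart of `C`. -/
def cmap (C : Set (PSpace d)) : PSpace d → Fin d → ℝ := chartMap (chartOf C)

/-- The Hilbert distance between `u` and `v` computed in an affine chart where the convex set
is `O`: writing the line through `u, v` as `t ↦ u + t(v-u)`, with boundary parameters
`tm = inf {t | u + t(v-u) ∈ O} ≤ 0` and `tp = sup {...} ≥ 1`, the cross-ratio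
`[a,u,v,b]` of `a = u + tm(v-u), u, v, b = u + tp(v-u)` equals `(tp(1-tm))/((-tm)(tp-1))`. -/
def hilbertDistChart (O : Set (Fin d → ℝ)) (u v : Fin d → ℝ) : ℝ :=
  if u = v then 0
  else
    (1 / 2) * Real.log
      ((sSup {t : ℝ | u + t • (v - u) ∈ O} * (1 - sInf {t : ℝ | u + t • (v - u) ∈ O})) /
        ((-(sInf {t : ℝ | u + t • (v - u) ∈ O})) * (sSup {t : ℝ | u + t • (v - u) ∈ O} - 1)))

/-- The Hilbert metric of a properly convex set `C` (open in its span). -/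
def hilbertDist (C : Set (PSpace d)) (x y : PSpace d) : ℝ :=
  hilbertDistChart (cmap C '' C) (cmap C x) (cmap C y)

/-- The closed projective line segment `[x,y]` contained in `closure C`. -/
def projSeg (C : Set (PSpace d)) (x y : PSpace d) : Set (PSpace d) :=
  {z ∈ closure C | cmap C z ∈ segment ℝ (cmap C x) (cmap C y)}

/-- The open projective line segment `(x,y)` contained in `closure C`. -/
def projOpenSeg (C : Set (PSpace d)) (x y : PSpace d) : Set (PSpace d) :=
  {z ∈ closure C | cmap C z ∈ openSegment ℝ (cmap C x) (cmap C y)}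

/-- The open face `F_C(x)` of a point `x ∈ closure C`: the set `{x}` together with all
`y ∈ closure C` such that some open line segment contained in `closure C` contains
both `x` and `y`. -/
def face (C : Set (PSpace d)) (x : PSpace d) : Set (PSpace d) :=
  insert x {y ∈ closure C | ∃ a ∈ closure C, ∃ b ∈ closure C,
    x ∈ projOpenSeg C a b ∧ y ∈ projOpenSeg C a b}

/-- The ideal boundary `∂_i C = closure C \ C`. -/
def idealBdry (C : Set (PSpace d)) : Set (PSpace d) := closure C \ C

/-- The dimension of a subset `B`, computed in the chart of the ambient convex set `C`. -/
def pdimIn (C B : Set (PSpace d)) : ℕ :=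
  Module.finrank ℝ (affineSpan ℝ (cmap C '' B)).direction

/-- The dimension of a convex subset of `P(ℝ^d)`. -/
def pdim (A : Set (PSpace d)) : ℕ := pdimIn A A

/-- The coarse dimension `cdim_C(A)` of a nonempty subset `A` of a properly convex set `C`
open in its span: the smallest `k` such that `A` is contained in an `R`-neighborhood (for the
Hilbert metric of `C`) of a `k`-dimensional convex subset `B ⊆ C`. -/
def cdim (C A : Set (PSpace d)) : ℕ :=
  sInf {k : ℕ | ∃ R : ℝ, 0 < R ∧ ∃ B : Set (PSpace d), B ⊆ C ∧
    Convex ℝ (cmap C '' B) ∧ pdimIn C B = k ∧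
    A ⊆ {p ∈ C | ∃ q ∈ B, hilbertDist C p q < R}}

/-- The cone over the standard open `(p-1)`-dimensional simplex: vectors whose first `p`
coordinates are positive and whose remaining coordinates vanish. -/
def simplexCone (p : ℕ) : Set (Fin d → ℝ) :=
  {v | (∀ i : Fin d, (i : ℕ) < p → 0 < v i) ∧ ∀ i : Fin d, p ≤ (i : ℕ) → v i = 0}

/-- `S` is the image under `g ∈ PGL_d(ℝ)` of the standard open simplex with `p` vertices. -/
def IsSimplexWithMap (p : ℕ) (S : Set (PSpace d)) (g : (Fin d → ℝ) ≃ₗ[ℝ] (Fin d → ℝ)) : Prop :=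
  S = {q : PSpace d | ∃ v ∈ simplexCone (d := d) p, ∃ hv : v ≠ 0,
        q = Projectivization.mk ℝ (g v) (by simpa using hv)}

/-- `S ⊆ P(ℝ^d)` is a simplex of dimension `k`. -/
def IsSimplexOfDim (k : ℕ) (S : Set (PSpace d)) : Prop :=
  k + 1 ≤ d ∧ ∃ g : (Fin d → ℝ) ≃ₗ[ℝ] (Fin d → ℝ), IsSimplexWithMap (k + 1) S g

/-- `S` is a simplex with vertices `v 0, …, v (p-1)` (so of dimension `p - 1`). -/
def HasVertices {p : ℕ} (S : Set (PSpace d)) (v : Fin p → PSpace d) : Prop :=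
  ∃ (hp : p ≤ d) (g : (Fin d → ℝ) ≃ₗ[ℝ] (Fin d → ℝ)),
    IsSimplexWithMap p S g ∧
    ∀ j : Fin p, v j = Projectivization.mk ℝ (g (Pi.single (Fin.castLE hp j) 1))
      (by
        simp only [ne_eq, EmbeddingLike.map_eq_zero_iff]
        intro h
        have h1 := congrFun h (Fin.castLE hp j)
        rw [Pi.single_eq_same] at h1
        exact one_ne_zero (α := ℝ) h1)

/-- `A ⊆ B` is properly embedded if the inclusion map `A ↪ B` is proper. -/
def IsProperlyEmbedded (A B : Set (PSpace d)) : Prop :=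
  ∃ h : A ⊆ B, IsProperMap (Set.inclusion h)

/-- The projective action of `GL(ℝ^d)` (hence of `PGL_d(ℝ)`) on `P(ℝ^d)`. -/
def pact (g : (Fin d → ℝ) ≃ₗ[ℝ] (Fin d → ℝ)) : PSpace d → PSpace d :=
  Projectivization.map g.toLinearMap g.injective

/-- A naive convex co-compact triple `(Ω, C, Λ)`. -/
structure NCCTriple (d : ℕ) where
  Ω : Set (PSpace d)
  C : Set (PSpace d)
  Λ : Subgroup ((Fin d → ℝ) ≃ₗ[ℝ] (Fin d → ℝ))
  isOpen_Ω : IsOpen Ω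
  nonempty_Ω : Ω.Nonempty
  properlyConvex_Ω : IsProperlyConvex Ω
  inv_Ω : ∀ g ∈ Λ, pact g '' Ω = Ω
  infinite_Λ : (Λ : Set ((Fin d → ℝ) ≃ₗ[ℝ] (Fin d → ℝ))).Infinite
  discrete_Λ : ∀ K ⊆ Ω, IsCompact K →
    {g : (Fin d → ℝ) ≃ₗ[ℝ] (Fin d → ℝ) | g ∈ Λ ∧ (pact g '' K ∩ K).Nonempty}.Finite
  C_nonempty : C.Nonempty
  C_sub : C ⊆ Ω
  C_closedInΩ : closure C ∩ Ω ⊆ C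
  C_convex : Convex ℝ (cmap Ω '' C)
  inv_C : ∀ g ∈ Λ, pact g '' C = C
  cocompact : ∃ K : Set (PSpace d), K ⊆ C ∧ IsCompact K ∧ C ⊆ ⋃ g ∈ Λ, pact g '' K

/-- The orbit of a point under a subgroup of `PGL_d(ℝ)`. -/
def porbit (Λ : Subgroup ((Fin d → ℝ) ≃ₗ[ℝ] (Fin d → ℝ))) (p : PSpace d) : Set (PSpace d) :=
  {q | ∃ g ∈ Λ, q = pact g p}

/-- The full orbital limit set `L_Ω(Λ)`. -/
def limitSet (Ω : Set (PSpace d)) (Λ : Subgroup ((Fin d → ℝ) ≃ₗ[ℝ] (Fin d → ℝ))) :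
    Set (PSpace d) :=
  ⋃ p ∈ Ω, (closure (porbit Λ p) \ porbit Λ p)

/-- The convex hull of `X ⊆ closure Ω` taken inside `Ω`. -/
def convHullIn (Ω X : Set (PSpace d)) : Set (PSpace d) :=
  {z ∈ Ω | cmap Ω z ∈ convexHull ℝ (cmap Ω '' X)}

/-- `C_Ω(Λ)`: the convex hull of the full orbital limit set in `Ω`. -/
def coreC (Ω : Set (PSpace d)) (Λ : Subgroup ((Fin d → ℝ) ≃ₗ[ℝ] (Fin d → ℝ))) :
    Set (PSpace d) :=
  convHullIn Ω (limitSet Ω Λ)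

/-- A convex co-compact group `Λ ⊆ Aut(Ω)`: an infinite discrete subgroup preserving `Ω`
such that `C_Ω(Λ)` is nonempty and `Λ` acts cocompactly on it. -/
structure CCSetup (d : ℕ) where
  Ω : Set (PSpace d)
  Λ : Subgroup ((Fin d → ℝ) ≃ₗ[ℝ] (Fin d → ℝ))
  isOpen_Ω : IsOpen Ω
  nonempty_Ω : Ω.Nonempty
  properlyConvex_Ω : IsProperlyConvex Ω
  inv_Ω : ∀ g ∈ Λ, pact g '' Ω = Ω
  infinite_Λ : (Λ : Set ((Fin d → ℝ) ≃ₗ[ℝ] (Fin d → ℝ))).Infinite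
  discrete_Λ : ∀ K ⊆ Ω, IsCompact K →
    {g : (Fin d → ℝ) ≃ₗ[ℝ] (Fin d → ℝ) | g ∈ Λ ∧ (pact g '' K ∩ K).Nonempty}.Finite
  core_nonempty : (coreC Ω Λ).Nonempty
  cocompact : ∃ K : Set (PSpace d), K ⊆ coreC Ω Λ ∧ IsCompact K ∧
    coreC Ω Λ ⊆ ⋃ g ∈ Λ, pact g '' K

/-- The Gromov product of `x, y` at `w`, with respect to the Hilbert metric of `Ω`. -/
def gromovProd (Ω : Set (PSpace d)) (w x y : PSpace d) : ℝ :=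
  (hilbertDist Ω x w + hilbertDist Ω y w - hilbertDist Ω x y) / 2

/-- `(C, d_Ω)` is Gromov hyperbolic. -/
def GromovHyperbolicOn (Ω C : Set (PSpace d)) : Prop :=
  ∃ δ : ℝ, 0 ≤ δ ∧ ∀ x ∈ C, ∀ y ∈ C, ∀ z ∈ C, ∀ w ∈ C,
    min (gromovProd Ω w x y) (gromovProd Ω w y z) - δ ≤ gromovProd Ω w x z

/-- The open Hilbert-metric ball in `Ω`. -/
def hBall (Ω : Set (PSpace d)) (x : PSpace d) (r : ℝ) : Set (PSpace d) :=
  {y ∈ Ω | hilbertDist Ω x y < r}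

/-- The Hausdorff distance between `A` and `B` (w.r.t. the Hilbert metric of `Ω`)
is less than `ε`. -/
def hausLT (Ω A B : Set (PSpace d)) (ε : ℝ) : Prop :=
  (∀ a ∈ A, ∃ b ∈ B, hilbertDist Ω a b < ε) ∧ ∀ b ∈ B, ∃ a ∈ A, hilbertDist Ω a b < ε

/-- The Hausdorff distance between `A` and `B` (w.r.t. the Hilbert metric of `Ω`)
is at most `r`. -/
def hausdorffDistLE (Ω A B : Set (PSpace d)) (r : ℝ) : Prop :=
  ∀ ε : ℝ, 0 < ε → hausLT Ω A B (r + ε)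

/-- Convergence `F n → C` in the local Hausdorff topology induced by `d_Ω`. -/
def LocalHausConv (Ω : Set (PSpace d)) (F : ℕ → Set (PSpace d)) (C : Set (PSpace d)) : Prop :=
  ∀ x ∈ Ω, ∀ r : ℝ, 0 < r → ∀ ε : ℝ, 0 < ε →
    ∀ᶠ n in atTop, hausLT Ω (F n ∩ hBall Ω x r) (C ∩ hBall Ω x r) ε

/-- A collection `𝒮` of closed subsets of `Ω` is closed and discrete in the local Hausdorff
topology: any sequence in `𝒮` converging to a nonempty closed subset of `Ω` has limit in `𝒮`
and is eventually equal to its limit. -/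
def ClosedAndDiscreteInLHT (Ω : Set (PSpace d)) (𝒮 : Set (Set (PSpace d))) : Prop :=
  ∀ F : ℕ → Set (PSpace d), (∀ n, F n ∈ 𝒮) →
    ∀ C : Set (PSpace d), C.Nonempty → C ⊆ Ω → closure C ∩ Ω ⊆ C → LocalHausConv Ω F C →
      C ∈ 𝒮 ∧ ∀ᶠ n in atTop, F n = C


section PartA
open Topology
variable {d : ℕ}

theorem mk'_isOpenQuotientMap :
    IsOpenQuotientMap (fun v : {v : Fin d → ℝ // v ≠ 0} => (Projectivization.mk ℝ v.1 v.2 : PSpace d)) := by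
  have hcont : Continuous (fun v : {v : Fin d → ℝ // v ≠ 0} => (Projectivization.mk ℝ v.1 v.2 : PSpace d)) :=
    continuous_quotient_mk'
  have hq : IsQuotientMap (fun v : {v : Fin d → ℝ // v ≠ 0} => (Projectivization.mk ℝ v.1 v.2 : PSpace d)) :=
    isQuotientMap_quotient_mk'
  refine ⟨hq.surjective, hcont, ?_⟩
  intro U hU
  rw [← hq.isOpen_preimage]
  have : ((fun v : {v : Fin d → ℝ // v ≠ 0} => (Projectivization.mk ℝ v.1 v.2 : PSpace d)) ⁻¹'
      ((fun v : {v : Fin d → ℝ // v ≠ 0} => (Projectivization.mk ℝ v.1 v.2 : PSpace d)) '' U)) =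
      ⋃ a : ℝˣ, {v : {v : Fin d → ℝ // v ≠ 0} |
        (⟨a • v.1, (smul_ne_zero_iff_ne a).2 v.2⟩ : {v : Fin d → ℝ // v ≠ 0}) ∈ U} := by
    ext v
    simp only [mem_preimage, mem_image, mem_iUnion, mem_ofPred_eq]
    constructor
    · rintro ⟨u, hu, h⟩
      rw [Projectivization.mk_eq_mk_iff] at h
      obtain ⟨a, ha⟩ := h
      refine ⟨a, ?_⟩
      convert hu
    · rintro ⟨a, ha⟩
      refine ⟨_, ha, ?_⟩
      rw [Projectivization.mk_eq_mk_iff]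
      exact ⟨a, rfl⟩
  rw [this]
  refine isOpen_iUnion fun a => hU.preimage ?_
  refine Continuous.subtype_mk ?_ _
  exact continuous_const_smul a |>.comp continuous_subtype_val

/-- the cone of representatives -/
def pcone (A : Set (PSpace d)) : Set (Fin d → ℝ) := {x | ∃ h : x ≠ 0, Projectivization.mk ℝ x h ∈ A}

theorem isOpen_pcone {A : Set (PSpace d)} (hA : IsOpen A) : IsOpen (pcone A) := by
  have h1 := hA.preimage (mk'_isOpenQuotientMap (d := d)).continuous
  have h2 : IsOpenMap (Subtype.val : {v : Fin d → ℝ // v ≠ 0} → _) :=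
    (isOpen_ne (x := (0 : Fin d → ℝ))).isOpenMap_subtype_val
  convert h2 _ h1 using 1
  ext x
  simp [pcone]

theorem mk_mem_closure {A : Set (PSpace d)} {x : Fin d → ℝ} (hx : x ≠ 0) (h : x ∈ closure (pcone A)) :
    Projectivization.mk ℝ x hx ∈ closure A := by
  have hc : ContinuousAt (fun v : {v : Fin d → ℝ // v ≠ 0} => (Projectivization.mk ℝ v.1 v.2 : PSpace d)) ⟨x, hx⟩ :=
    (mk'_isOpenQuotientMap (d := d)).continuous.continuousAt
  have h3 : (⟨x, hx⟩ : {v : Fin d → ℝ // v ≠ 0}) ∈ closure ((fun v : {v : Fin d → ℝ // v ≠ 0} => (Projectivization.mk ℝ v.1 v.2 : PSpace d)) ⁻¹' A) := by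
    rw [closure_subtype]
    convert h
    ext y
    simp [pcone]
  have := mem_closure_image hc h3
  exact closure_mono (image_preimage_subset _ _) this

theorem chartMap_mk (f : (Fin d → ℝ) →ₗ[ℝ] ℝ) (x : Fin d → ℝ) (hx : x ≠ 0) :
    chartMap f (Projectivization.mk ℝ x hx) = (f x)⁻¹ • x := by
  obtain ⟨a, ha⟩ := Projectivization.exists_smul_eq_mk_rep ℝ x hx
  unfold chartMap
  rw [← ha, Units.smul_def, map_smul, smul_smul]
  congr 1
  rw [smul_eq_mul, mul_inv_rev, mul_assoc, inv_mul_cancel₀ a.ne_zero, mul_one]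

theorem f_rep_mk_ne_zero (f : (Fin d → ℝ) →ₗ[ℝ] ℝ) (x : Fin d → ℝ) (hx : x ≠ 0) :
    f (Projectivization.mk ℝ x hx).rep ≠ 0 ↔ f x ≠ 0 := by
  obtain ⟨a, ha⟩ := Projectivization.exists_smul_eq_mk_rep ℝ x hx
  rw [← ha, Units.smul_def, map_smul]
  simp

theorem mk_smul (x : Fin d → ℝ) (hx : x ≠ 0) (c : ℝ) (hc : c • x ≠ 0) :
    Projectivization.mk ℝ (c • x) hc = Projectivization.mk ℝ x hx := by
  rw [Projectivization.mk_eq_mk_iff']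
  exact ⟨c, rfl⟩

theorem chartMap_eq_one (f : (Fin d → ℝ) →ₗ[ℝ] ℝ) {x : PSpace d} (hx : f x.rep ≠ 0) :
    f (chartMap f x) = 1 := by
  simp [chartMap, hx]

theorem chartMap_ne_zero (f : (Fin d → ℝ) →ₗ[ℝ] ℝ) {x : PSpace d} (hx : f x.rep ≠ 0) :
    chartMap f x ≠ 0 := by
  intro h
  have := chartMap_eq_one f hx
  simp [h] at this

theorem mk_chartMap (f : (Fin d → ℝ) →ₗ[ℝ] ℝ) {x : PSpace d} (h : chartMap f x ≠ 0) :
    Projectivization.mk ℝ (chartMap f x) h = x := by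
  conv_rhs => rw [← x.mk_rep]
  exact mk_smul _ _ _ _

theorem continuousAt_chartMap (f : (Fin d → ℝ) →ₗ[ℝ] ℝ) {x : PSpace d} (hx : f x.rep ≠ 0) :
    ContinuousAt (chartMap f) x := by
  have hf : Continuous f := f.continuous_of_finiteDimensional
  rw [← x.mk_rep]
  rw [show Projectivization.mk ℝ x.rep x.rep_nonzero =
    (fun v : {v : Fin d → ℝ // v ≠ 0} => (Projectivization.mk ℝ v.1 v.2 : PSpace d)) ⟨x.rep, x.rep_nonzero⟩ from rfl]
  rw [← (mk'_isOpenQuotientMap (d := d)).continuousAt_comp_iff]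
  have : chartMap f ∘ (fun v : {v : Fin d → ℝ // v ≠ 0} => (Projectivization.mk ℝ v.1 v.2 : PSpace d)) =
    fun v => (f v.1)⁻¹ • v.1 := by
    ext1 v
    exact chartMap_mk f v.1 v.2
  rw [this]
  have h1 : ContinuousAt (fun v : {v : Fin d → ℝ // v ≠ 0} => f v.1) ⟨x.rep, x.rep_nonzero⟩ :=
    (hf.comp continuous_subtype_val).continuousAt
  exact (h1.inv₀ hx).smul continuous_subtype_val.continuousAt

theorem chartOf_spec {C : Set (PSpace d)} (h : IsProperlyConvex C) :
    (∀ x ∈ closure C, chartOf C x.rep ≠ 0) ∧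
    Convex ℝ (cmap C '' C) ∧ Bornology.IsBounded (cmap C '' C) := by
  have := h.choose_spec
  unfold cmap chartOf
  rw [dif_pos h]
  exact this

theorem exists_equiv {p : ℕ} (hp : p ≤ d) (V : Fin p → Fin d → ℝ) (hV : LinearIndependent ℝ V) :
    ∃ g : (Fin d → ℝ) ≃ₗ[ℝ] (Fin d → ℝ), ∀ j, g (Pi.single (Fin.castLE hp j) 1) = V j := by
  have hE : LinearIndependent ℝ (fun j : Fin p => (Pi.single (Fin.castLE hp j) 1 : Fin d → ℝ)) := by
    have := (Pi.basisFun ℝ (Fin d)).linearIndependent.comp (Fin.castLE hp) (Fin.castLE_injective hp)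
    convert this using 1
    ext1 j
    simp
  let e := (Module.Basis.span hE).equiv (Module.Basis.span hV) (Equiv.refl _)
  obtain ⟨g, hg⟩ := Submodule.exists_linearEquiv_restrict_eq e
  refine ⟨g, fun j => ?_⟩
  have h1 := hg ⟨_, Submodule.subset_span (mem_range_self j)⟩
  rw [← h1]
  have h2 : e (Module.Basis.span hE j) = Module.Basis.span hV j := by
    simp only [e, Module.Basis.equiv_apply, Equiv.refl_apply]
  have h3 := congrArg Subtype.val h2
  rw [Module.Basis.span_apply] at h3
  exact h3.trans (congrArg Subtype.val (Module.Basis.span_apply hV j))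
end PartA

section PartB
open Topology
variable {d : ℕ}

/-- open convex cone -/
structure OCone (C : Set (Fin d → ℝ)) : Prop where
  op : IsOpen C
  ne : C.Nonempty
  add : ∀ x ∈ C, ∀ y ∈ C, x + y ∈ C
  smul : ∀ c : ℝ, 0 < c → ∀ x ∈ C, c • x ∈ C

namespace OCone
variable {C : Set (Fin d → ℝ)}

theorem cadd (h : OCone C) {x y : Fin d → ℝ} (hx : x ∈ closure C) (hy : y ∈ closure C) :
    x + y ∈ closure C :=
  map_mem_closure₂ continuous_add hx hy (fun a ha b hb => h.add a ha b hb)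

theorem zero_mem (h : OCone C) : (0 : Fin d → ℝ) ∈ closure C := by
  obtain ⟨x, hx⟩ := h.ne
  have h1 : Tendsto (fun c : ℝ => c • x) (𝓝[>] 0) (𝓝 0) := by
    have : Tendsto (fun c : ℝ => c • x) (𝓝 0) (𝓝 ((0 : ℝ) • x)) :=
      (continuous_id.smul continuous_const).tendsto 0
    rw [zero_smul] at this
    exact this.mono_left nhdsWithin_le_nhds
  refine mem_closure_of_tendsto h1 ?_
  filter_upwards [self_mem_nhdsWithin] with c hc
  exact h.smul c hc x hx

theorem csmul (h : OCone C) {c : ℝ} (hc : 0 ≤ c) {x : Fin d → ℝ} (hx : x ∈ closure C) :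
    c • x ∈ closure C := by
  rcases hc.eq_or_lt with rfl | hc
  · rw [zero_smul]; exact h.zero_mem
  · exact map_mem_closure (continuous_const_smul c) hx (fun a ha => h.smul c hc a ha)

theorem csum (h : OCone C) {ι : Type*} (s : Finset ι) (u : ι → Fin d → ℝ)
    (hu : ∀ i ∈ s, u i ∈ closure C) : ∑ i ∈ s, u i ∈ closure C :=
  Finset.sum_induction u (· ∈ closure C) (fun _ _ => h.cadd) h.zero_mem hu

theorem oadd (h : OCone C) {x y : Fin d → ℝ} (hx : x ∈ C) (hy : y ∈ closure C) :
    x + y ∈ C := by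
  have h1 : IsOpen {y' | x + y - y' ∈ C} :=
    h.op.preimage (continuous_const.sub continuous_id)
  obtain ⟨y', h2, h3⟩ := mem_closure_iff.1 hy _ h1 (by simpa using hx)
  have := h.add _ h2 _ h3
  simpa using this

/-- Transfer lemma. -/
theorem trans_mem (h : OCone C) {x y : Fin d → ℝ} {b : ℝ} (hb : 0 < b) (hy : y ∈ C)
    (hxy : b • x - y ∈ closure C) : x ∈ C := by
  have := h.oadd hy hxy
  rw [add_sub_cancel] at this
  have := h.smul b⁻¹ (by positivity) _ this
  rwa [smul_smul, inv_mul_cancel₀ hb.ne', one_smul] at this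

theorem sum_mem_iff (h : OCone C) {p : ℕ} {v w : Fin p → Fin d → ℝ}
    (hw : ∀ j, w j ∈ closure C)
    (H1 : ∀ a : Fin p → ℝ, (∀ j, 0 ≤ a j) → ∑ j, a j • v j ∈ C → ∀ j, 0 < a j)
    (H3 : ∀ j, ∃ b : ℝ, 0 < b ∧ b • v j - w j ∈ closure C)
    {c : Fin p → ℝ} (hc : ∑ j, c j • w j ∈ C) (j : Fin p) : 0 < c j := by
  choose b hb hbv using H3
  have h1 : ∑ j, max (c j) 0 • w j ∈ C := by
    have := h.oadd hc (h.csum Finset.univ (fun j => max (-c j) 0 • w j)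
      (fun j _ => h.csmul (le_max_right _ _) (hw j)))
    rw [← Finset.sum_add_distrib] at this
    convert this using 2 with j
    rw [← add_smul]
    congr 1
    rcases le_total (c j) 0 with h | h
    · rw [max_eq_right h, max_eq_left (by linarith)]; ring
    · rw [max_eq_left h, max_eq_right (by linarith)]; ring
  have h2 : ∑ j, (max (c j) 0 * b j) • v j ∈ C := by
    refine h.trans_mem (b := 1) one_pos h1 ?_
    rw [one_smul, ← Finset.sum_sub_distrib]
    refine h.csum _ _ fun j _ => ?_
    rw [mul_smul, ← smul_sub]
    exact h.csmul (le_max_right _ _) (hbv j)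
  have h3 := H1 _ (fun j => mul_nonneg (le_max_right _ _) (hb j).le) h2 j
  by_contra h4
  rw [max_eq_right (by linarith)] at h3
  simp at h3

theorem sum_mem (h : OCone C) {p : ℕ} {v w : Fin p → Fin d → ℝ}
    (H2 : ∀ a : Fin p → ℝ, (∀ j, 0 < a j) → ∑ j, a j • v j ∈ C)
    (H4 : ∀ j, ∃ b : ℝ, 0 < b ∧ b • w j - v j ∈ closure C)
    (c : Fin p → ℝ) (hc : ∀ j, 0 < c j) : ∑ j, c j • w j ∈ C := by
  choose b hb hbv using H4
  refine h.trans_mem (b := 1) one_pos (H2 (fun j => c j * (b j)⁻¹) (fun j => mul_pos (hc j) (inv_pos.2 (hb j)))) ?_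
  rw [one_smul, ← Finset.sum_sub_distrib]
  refine h.csum _ _ fun j _ => ?_
  have : c j • w j - (c j * (b j)⁻¹) • v j = (c j * (b j)⁻¹) • (b j • w j - v j) := by
    rw [smul_sub, smul_smul, mul_assoc, inv_mul_cancel₀ (hb j).ne', mul_one]
  rw [this]
  exact h.csmul (mul_pos (hc j) (inv_pos.2 (hb j))).le (hbv j)

theorem li_of {p : ℕ} {w : Fin p → Fin d → ℝ}
    (H : ∀ c : Fin p → ℝ, ∑ j, c j • w j ∈ C ↔ ∀ j, 0 < c j) : LinearIndependent ℝ w := by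
  rw [Fintype.linearIndependent_iff]
  intro c hc i
  by_contra hci
  have h1 := (H (fun j => 1 - (c i)⁻¹ * c j)).1 (by
    have h2 := (H (fun _ => 1)).2 (fun _ => one_pos)
    convert h2 using 1
    simp only [sub_smul, Finset.sum_sub_distrib, mul_smul, ← Finset.smul_sum, hc]
    simp) i
  rw [inv_mul_cancel₀ hci] at h1
  simp at h1

end OCone

theorem intrinsicInterior_simplex {p : ℕ} (w : Fin p → Fin d → ℝ) (hw : LinearIndependent ℝ w) :
    intrinsicInterior ℝ (convexHull ℝ (range w)) =
      {x | ∃ a : Fin p → ℝ, (∀ j, 0 < a j) ∧ ∑ j, a j = 1 ∧ x = ∑ j, a j • w j} := by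
  have hp : p ≤ d := by simpa using hw.fintype_card_le_finrank
  obtain ⟨g, hg⟩ := exists_equiv hp w hw
  let φ : Fin p → (Fin d → ℝ) → ℝ := fun j x => g.symm x (Fin.castLE hp j)
  have hφc : ∀ j, Continuous (φ j) := fun j =>
    (continuous_apply _).comp (LinearMap.continuous_of_finiteDimensional g.symm.toLinearMap)
  have hφ : ∀ (j : Fin p) (a : Fin p → ℝ), φ j (∑ i, a i • w i) = a j := by
    intro j a
    simp only [φ, map_sum, map_smul, ← hg, LinearEquiv.symm_apply_apply, Finset.sum_apply, Pi.smul_apply,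
      smul_eq_mul]
    rw [Finset.sum_eq_single j]
    · simp
    · intro b _ hb
      rw [Pi.single_eq_of_ne (fun h => hb (Fin.castLE_injective hp h).symm)]
      simp
    · simp
  have hhull : ∀ x, x ∈ convexHull ℝ (range w) ↔ ∃ a : Fin p → ℝ, (∀ j, 0 ≤ a j) ∧ ∑ j, a j = 1 ∧ x = ∑ j, a j • w j := by
    intro x
    rw [convexHull_range_eq_exists_affineCombination]
    constructor
    · rintro ⟨s, a, ha, ha1, rfl⟩
      refine ⟨fun j => if j ∈ s then a j else 0, ?_, ?_, ?_⟩
      · intro j; dsimp only; split_ifs with h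
        · exact ha j h
        · exact le_rfl
      · simpa using ha1
      · rw [Finset.affineCombination_eq_linear_combination _ _ _ ha1]
        simp
    · rintro ⟨a, ha, ha1, rfl⟩
      refine ⟨Finset.univ, a, fun j _ => ha j, ha1, ?_⟩
      rw [Finset.affineCombination_eq_linear_combination _ _ _ ha1]
  have hspan : ∀ x, x ∈ affineSpan ℝ (convexHull ℝ (range w)) → ∃ a : Fin p → ℝ, ∑ j, a j = 1 ∧ x = ∑ j, a j • w j := by
    intro x hx
    rw [affineSpan_convexHull] at hx
    obtain ⟨a, ha1, rfl⟩ := eq_affineCombination_of_mem_affineSpan_of_fintype hx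
    refine ⟨a, ha1, ?_⟩
    rw [Finset.affineCombination_eq_linear_combination _ _ _ ha1]
  ext x
  rw [mem_intrinsicInterior]
  constructor
  · rintro ⟨y, hy, rfl⟩
    have hy1 : y.1 ∈ convexHull ℝ (range w) := mem_preimage.1 (interior_subset hy)
    obtain ⟨a, ha, ha1, hya⟩ := (hhull y.1).1 hy1
    refine ⟨a, fun j => ?_, ha1, hya⟩
    refine lt_of_le_of_ne (ha j) fun h0 => ?_
    have hwj : w j ∈ affineSpan ℝ (convexHull ℝ (range w)) :=
      subset_affineSpan ℝ _ (subset_convexHull ℝ _ (mem_range_self j))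
    let γ : ℝ → affineSpan ℝ (convexHull ℝ (range w)) := fun t =>
      ⟨AffineMap.lineMap y.1 (w j) t, AffineMap.lineMap_mem t y.2 hwj⟩
    have hγ : Continuous γ := by
      refine Continuous.subtype_mk ?_ _
      exact AffineMap.lineMap_continuous
    have hγ0 : γ 0 = y := Subtype.ext (by simp [γ])
    have h1 : ∀ᶠ t in 𝓝 (0 : ℝ), γ t ∈ interior ((↑) ⁻¹' convexHull ℝ (range w) : Set (affineSpan ℝ (convexHull ℝ (range w)))) := by
      refine hγ.continuousAt.eventually_mem ?_
      rw [hγ0]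
      exact isOpen_interior.mem_nhds hy
    obtain ⟨ε, hε, hb⟩ := Metric.eventually_nhds_iff.1 h1
    have h2 := interior_subset (hb (y := -(ε/2)) (by
      rw [Real.dist_eq, sub_zero, abs_neg, abs_of_pos (by linarith)]; linarith))
    obtain ⟨b, hb0, -, hb2⟩ := (hhull _).1 h2
    have h3 : φ j (AffineMap.lineMap y.1 (w j) (-(ε/2))) = b j := by
      rw [← hφ j b, ← hb2]
    have h4 : AffineMap.lineMap y.1 (w j) (-(ε/2)) = ∑ i, ((1 + ε/2) * a i + if i = j then -(ε/2) else 0) • w i := by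
      rw [AffineMap.lineMap_apply_module, hya]
      simp only [add_smul, Finset.sum_add_distrib, mul_smul, ← Finset.smul_sum, ite_smul, zero_smul,
        Finset.sum_ite_eq', Finset.mem_univ, if_true]
      module
    rw [h4, hφ, ← h0] at h3
    simp at h3
    have := hb0 j
    linarith
  · rintro ⟨a, ha, ha1, rfl⟩
    have hmem : ∑ j, a j • w j ∈ convexHull ℝ (range w) := (hhull _).2 ⟨a, fun j => (ha j).le, ha1, rfl⟩
    refine ⟨⟨_, subset_affineSpan ℝ _ hmem⟩, ?_, rfl⟩
    rw [mem_interior]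
    refine ⟨{y | ∀ j, 0 < φ j y.1}, ?_, ?_, ?_⟩
    · intro y hy
      obtain ⟨b, hb1, hb⟩ := hspan y.1 y.2
      refine (hhull _).2 ⟨b, fun j => ?_, hb1, hb⟩
      have := hy j
      rw [hb, hφ] at this
      exact this.le
    · simp only [ofPred_forall]
      exact isOpen_iInter_of_finite fun j => isOpen_lt continuous_const ((hφc j).comp continuous_subtype_val)
    · intro j
      dsimp only
      rw [hφ]; exact ha j
end PartB

section PartC
open Topology
variable {d : ℕ}

/-- the open cone over `Ω` -/
def oc (Ω : Set (PSpace d)) : Set (Fin d → ℝ) := {x | 0 < chartOf Ω x} ∩ pcone Ω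

variable {Ω : Set (PSpace d)}

theorem rep_ne (hΩ : IsPCDomain Ω) {x : PSpace d} (hx : x ∈ closure Ω) : chartOf Ω x.rep ≠ 0 :=
  (chartOf_spec hΩ.2.2).1 x hx

theorem cmap_one (hΩ : IsPCDomain Ω) {x : PSpace d} (hx : x ∈ closure Ω) : chartOf Ω (cmap Ω x) = 1 :=
  chartMap_eq_one _ (rep_ne hΩ hx)

theorem cmap_inj (hΩ : IsPCDomain Ω) {x y : PSpace d} (hx : x ∈ closure Ω) (hy : y ∈ closure Ω)
    (h : cmap Ω x = cmap Ω y) : x = y := by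
  have hx' := rep_ne hΩ hx
  have hy' := rep_ne hΩ hy
  rw [← mk_chartMap _ (chartMap_ne_zero _ hx'), ← mk_chartMap _ (chartMap_ne_zero _ hy')]
  congr 1

theorem mem_oc_of_mem (hΩ : IsPCDomain Ω) {x : PSpace d} (hx : x ∈ Ω) : cmap Ω x ∈ oc Ω := by
  have hx' := rep_ne hΩ (subset_closure hx)
  refine ⟨?_, chartMap_ne_zero _ hx', ?_⟩
  · rw [mem_ofPred_eq, cmap_one hΩ (subset_closure hx)]; exact one_pos
  · unfold cmap
    rw [mk_chartMap]; exact hx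

theorem mem_image_of_oc {x : Fin d → ℝ} (hx : x ∈ oc Ω) :
    (chartOf Ω x)⁻¹ • x ∈ cmap Ω '' Ω := by
  obtain ⟨h1, h2, h3⟩ := hx
  exact ⟨_, h3, chartMap_mk _ _ _⟩

theorem oc_smul {x : Fin d → ℝ} (hx : x ∈ oc Ω) {c : ℝ} (hc : 0 < c) : c • x ∈ oc Ω := by
  obtain ⟨h1, h2, h3⟩ := hx
  refine ⟨?_, smul_ne_zero hc.ne' h2, ?_⟩
  · rw [mem_ofPred_eq, map_smul]; exact mul_pos hc h1
  · rw [mk_smul x h2]; exact h3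

theorem image_eq (hΩ : IsPCDomain Ω) {x : Fin d → ℝ} :
    x ∈ cmap Ω '' Ω ↔ x ∈ oc Ω ∧ chartOf Ω x = 1 := by
  constructor
  · rintro ⟨y, hy, rfl⟩
    exact ⟨mem_oc_of_mem hΩ hy, cmap_one hΩ (subset_closure hy)⟩
  · rintro ⟨h1, h2⟩
    have := mem_image_of_oc h1
    rwa [h2, inv_one, one_smul] at this

theorem ocone (hΩ : IsPCDomain Ω) : OCone (oc Ω) where
  op := (isOpen_lt continuous_const (LinearMap.continuous_of_finiteDimensional _)).inter
    (isOpen_pcone hΩ.1)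
  ne := by
    obtain ⟨x, hx⟩ := hΩ.2.1
    exact ⟨_, mem_oc_of_mem hΩ hx⟩
  smul := fun c hc x hx => oc_smul hx hc
  add := by
    intro x hx y hy
    have hx1 : 0 < chartOf Ω x := hx.1
    have hy1 : 0 < chartOf Ω y := hy.1
    have h1 := (chartOf_spec hΩ.2.2).2.1 (mem_image_of_oc hx) (mem_image_of_oc hy)
      (show 0 ≤ chartOf Ω x / (chartOf Ω x + chartOf Ω y) by positivity)
      (show 0 ≤ chartOf Ω y / (chartOf Ω x + chartOf Ω y) by positivity) (by field_simp)
    have h2 := oc_smul ((image_eq hΩ).1 h1).1 (add_pos hx1 hy1)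
    convert h2 using 1
    rw [smul_add, smul_smul, smul_smul, smul_smul, smul_smul]
    congr 1
    · rw [show (chartOf Ω x + chartOf Ω y) * (chartOf Ω x / (chartOf Ω x + chartOf Ω y)) * (chartOf Ω x)⁻¹ = 1 by
        field_simp, one_smul]
    · rw [show (chartOf Ω x + chartOf Ω y) * (chartOf Ω y / (chartOf Ω x + chartOf Ω y)) * (chartOf Ω y)⁻¹ = 1 by
        field_simp, one_smul]

theorem cmap_mem_closure (hΩ : IsPCDomain Ω) {x : PSpace d} (hx : x ∈ closure Ω) :
    cmap Ω x ∈ closure (cmap Ω '' Ω) :=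
  mem_closure_image (continuousAt_chartMap _ (rep_ne hΩ hx)) hx

theorem cmap_mem_cc (hΩ : IsPCDomain Ω) {x : PSpace d} (hx : x ∈ closure Ω) :
    cmap Ω x ∈ closure (oc Ω) :=
  closure_mono (fun _ hy => ((image_eq hΩ).1 hy).1) (cmap_mem_closure hΩ hx)

theorem exists_of_cc {k : Fin d → ℝ} (hk : k ∈ closure (oc Ω)) (h1 : chartOf Ω k = 1) :
    ∃ x ∈ closure Ω, cmap Ω x = k := by
  have hk0 : k ≠ 0 := by rintro rfl; simp at h1
  refine ⟨_, mk_mem_closure hk0 (closure_mono inter_subset_right hk), ?_⟩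
  unfold cmap
  rw [chartMap_mk, h1, inv_one, one_smul]

theorem mem_of_oc (hΩ : IsPCDomain Ω) {x : PSpace d} (hx : x ∈ closure Ω) (h : cmap Ω x ∈ oc Ω) : x ∈ Ω := by
  obtain ⟨y, hy, hyx⟩ := (image_eq hΩ).2 ⟨h, cmap_one hΩ hx⟩
  rw [← cmap_inj hΩ (subset_closure hy) hx hyx]; exact hy

/-- line parameters are bounded -/
theorem bdd_line {O : Set (Fin d → ℝ)} (hO : Bornology.IsBounded O) {u v : Fin d → ℝ} (huv : u ≠ v) :
    Bornology.IsBounded {t : ℝ | u + t • (v - u) ∈ O} := by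
  obtain ⟨R, hR⟩ := hO.exists_norm_le
  have hpos : 0 < ‖v - u‖ := norm_pos_iff.2 (sub_ne_zero.2 huv.symm)
  rw [isBounded_iff_forall_norm_le]
  refine ⟨(R + ‖u‖) / ‖v - u‖, fun t ht => ?_⟩
  rw [le_div_iff₀ hpos, ← norm_smul]
  have h1 := hR _ ht
  have h2 : t • (v - u) = (u + t • (v - u)) - u := by abel
  rw [h2]
  exact (norm_sub_le _ _).trans (by linarith)

theorem hilbert_le (hΩ : IsPCDomain Ω) {x y : Fin d → ℝ} (hx : x ∈ cmap Ω '' Ω) (hy : y ∈ cmap Ω '' Ω)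
    {α β : ℝ} (hα : α • y - x ∈ closure (oc Ω)) (hβ : β • x - y ∈ closure (oc Ω)) :
    hilbertDistChart (cmap Ω '' Ω) x y ≤ 1 / 2 * Real.log (α * β) := by
  have hC := ocone hΩ
  have hx' := (image_eq hΩ).1 hx
  have hy' := (image_eq hΩ).1 hy
  have hpos : ∀ z ∈ closure (oc Ω), 0 ≤ chartOf Ω z := by
    intro z hz
    have hcl : IsClosed {z | 0 ≤ chartOf Ω z} :=
      isClosed_le continuous_const (LinearMap.continuous_of_finiteDimensional _)
    exact closure_minimal (fun w hw => (show 0 < chartOf Ω w from hw.1).le) hcl hz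
  have hα1 : 1 ≤ α := by
    have := hpos _ hα
    rw [map_sub, map_smul, hx'.2, hy'.2] at this
    simp at this; linarith
  have hβ1 : 1 ≤ β := by
    have := hpos _ hβ
    rw [map_sub, map_smul, hx'.2, hy'.2] at this
    simp at this; linarith
  unfold hilbertDistChart
  split_ifs with hxy
  · have := Real.log_nonneg (one_le_mul_of_one_le_of_one_le hα1 hβ1)
    linarith
  have bd := bdd_line (chartOf_spec hΩ.2.2).2.2 hxy
  set T := {t : ℝ | x + t • (y - x) ∈ cmap Ω '' Ω} with hT
  have ext1 : ∀ s : ℝ, 0 ≤ s → s * (α - 1) < 1 → 1 + s ∈ T := by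
    intro s hs hs1
    rw [hT, mem_ofPred_eq, image_eq hΩ]
    constructor
    · have : x + (1 + s) • (y - x) = (1 - s * (α - 1)) • y + s • (α • y - x) := by module
      rw [this]
      exact hC.oadd (oc_smul hy'.1 (by linarith)) (hC.csmul hs hα)
    · rw [map_add, map_smul, map_sub, hx'.2, hy'.2]; simp
  have ext2 : ∀ s : ℝ, 0 ≤ s → s * (β - 1) < 1 → -s ∈ T := by
    intro s hs hs1
    rw [hT, mem_ofPred_eq, image_eq hΩ]
    constructor
    · have : x + (-s) • (y - x) = (1 - s * (β - 1)) • x + s • (β • x - y) := by module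
      rw [this]
      exact hC.oadd (oc_smul hx'.1 (by linarith)) (hC.csmul hs hβ)
    · rw [map_add, map_smul, map_sub, hx'.2, hy'.2]; simp
  have hα2 : 1 < α := by
    refine lt_of_le_of_ne hα1 fun h => ?_
    obtain ⟨M, hM⟩ := bd.bddAbove
    have := hM (ext1 (|M|) (abs_nonneg _) (by rw [← h]; simp))
    linarith [le_abs_self M]
  have hβ2 : 1 < β := by
    refine lt_of_le_of_ne hβ1 fun h => ?_
    obtain ⟨M, hM⟩ := bd.bddBelow
    have := hM (ext2 (|M| + 1) (by positivity) (by rw [← h]; simp))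
    linarith [neg_abs_le M]
  have hsup : 1 + 1 / (α - 1) ≤ sSup T := by
    refine le_of_forall_lt fun c hc => ?_
    have h0 : 0 < 1 / (α - 1) := by apply one_div_pos.2; linarith
    obtain ⟨s, hs1, hs2⟩ := exists_between (max_lt (show c - 1 < 1 / (α - 1) by linarith) h0)
    have hs3 := max_lt_iff.1 hs1
    have := le_csSup bd.bddAbove (ext1 s hs3.2.le (by rwa [lt_div_iff₀ (by linarith)] at hs2))
    linarith
  have hinf : sInf T ≤ -(1 / (β - 1)) := by
    refine le_of_forall_gt fun c hc => ?_
    have h0 : 0 < 1 / (β - 1) := by apply one_div_pos.2; linarith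
    obtain ⟨s, hs1, hs2⟩ := exists_between (max_lt (show -c < 1 / (β - 1) by linarith) h0)
    have hs3 := max_lt_iff.1 hs1
    have := csInf_le bd.bddBelow (ext2 s hs3.2.le (by rwa [lt_div_iff₀ (by linarith)] at hs2))
    linarith
  have h0 : 0 < 1 / (α - 1) := by apply one_div_pos.2; linarith
  have h0' : 0 < 1 / (β - 1) := by apply one_div_pos.2; linarith
  have e1 : sSup T / (sSup T - 1) ≤ α := by
    rw [div_le_iff₀ (by linarith)]
    have : 1 ≤ (sSup T - 1) * (α - 1) := by
      rw [← div_le_iff₀ (by linarith)]; linarith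
    nlinarith
  have e2 : (1 - sInf T) / (-sInf T) ≤ β := by
    rw [div_le_iff₀ (by linarith)]
    have : 1 ≤ (-sInf T) * (β - 1) := by
      rw [← div_le_iff₀ (by linarith)]; linarith
    nlinarith
  have e3 : 0 < sSup T / (sSup T - 1) := div_pos (by linarith) (by linarith)
  have e4 : 0 < (1 - sInf T) / (-sInf T) := div_pos (by linarith) (by linarith)
  have e5 : (sSup T * (1 - sInf T)) / ((-(sInf T)) * (sSup T - 1)) = 
    (sSup T / (sSup T - 1)) * ((1 - sInf T) / (-sInf T)) := by
    rw [div_mul_div_comm, mul_comm (-sInf T)]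
  rw [e5]
  have := Real.log_le_log (mul_pos e3 e4) (mul_le_mul e1 e2 e4.le (by linarith))
  linarith
end PartC

section PartD
open Topology
variable {d : ℕ} {Ω : Set (PSpace d)}

theorem mem_openSeg {a b x : Fin d → ℝ} : x ∈ openSegment ℝ a b ↔ ∃ t : ℝ, 0 < t ∧ t < 1 ∧ x = a + t • (b - a) := by
  rw [openSegment_eq_image']
  constructor
  · rintro ⟨t, ht, rfl⟩; exact ⟨t, ht.1, ht.2, rfl⟩
  · rintro ⟨t, h1, h2, rfl⟩; exact ⟨t, ⟨h1, h2⟩, rfl⟩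

theorem cc_line (hΩ : IsPCDomain Ω) {a b : Fin d → ℝ} (ha : a ∈ closure (oc Ω)) (hb : b ∈ closure (oc Ω))
    {t : ℝ} (h0 : 0 ≤ t) (h1 : t ≤ 1) : a + t • (b - a) ∈ closure (oc Ω) := by
  have : a + t • (b - a) = (1 - t) • a + t • b := by module
  rw [this]
  exact (ocone hΩ).cadd ((ocone hΩ).csmul (by linarith) ha) ((ocone hΩ).csmul h0 hb)

theorem face_sub {v : PSpace d} (hv : v ∈ closure Ω) : face Ω v ⊆ closure Ω := by
  rintro y (rfl | hy)
  · exact hv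
  · exact hy.1

theorem face_eps (hΩ : IsPCDomain Ω) {v y : PSpace d} (hv : v ∈ closure Ω) (hy : y ∈ face Ω v) :
    ∃ ε : ℝ, 0 < ε ∧ cmap Ω v + ε • (cmap Ω v - cmap Ω y) ∈ closure (oc Ω) ∧
      cmap Ω y + ε • (cmap Ω y - cmap Ω v) ∈ closure (oc Ω) := by
  rcases hy with rfl | ⟨hy, a, ha, b, hb, ⟨-, h1⟩, ⟨-, h2⟩⟩
  · refine ⟨1, one_pos, ?_, ?_⟩ <;> simpa using cmap_mem_cc hΩ hv
  · obtain ⟨s, hs0, hs1, hs⟩ := mem_openSeg.1 h1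
    obtain ⟨t, ht0, ht1, ht⟩ := mem_openSeg.1 h2
    have ha' := cmap_mem_cc hΩ ha
    have hb' := cmap_mem_cc hΩ hb
    obtain ⟨ε, hε0, hε⟩ := exists_between (show 0 < min (min s (1 - s)) (min t (1 - t)) from
      lt_min (lt_min hs0 (by linarith)) (lt_min ht0 (by linarith)))
    simp only [lt_min_iff] at hε
    refine ⟨ε, hε0, ?_, ?_⟩
    · rw [hs, ht, show cmap Ω a + s • (cmap Ω b - cmap Ω a) + ε • (cmap Ω a + s • (cmap Ω b - cmap Ω a) - (cmap Ω a + t • (cmap Ω b - cmap Ω a))) = cmap Ω a + (s + ε * (s - t)) • (cmap Ω b - cmap Ω a) by module]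
      apply cc_line hΩ ha' hb' <;> nlinarith
    · rw [hs, ht, show cmap Ω a + t • (cmap Ω b - cmap Ω a) + ε • (cmap Ω a + t • (cmap Ω b - cmap Ω a) - (cmap Ω a + s • (cmap Ω b - cmap Ω a))) = cmap Ω a + (t + ε * (t - s)) • (cmap Ω b - cmap Ω a) by module]
      apply cc_line hΩ ha' hb' <;> nlinarith

theorem face_line (hΩ : IsPCDomain Ω) {v : PSpace d} (hv : v ∈ closure Ω) {y : Fin d → ℝ} (hy : chartOf Ω y = 1)
    {ε : ℝ} (hε : 0 < ε) (h1 : cmap Ω v + ε • (cmap Ω v - y) ∈ closure (oc Ω))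
    (h2 : y + ε • (y - cmap Ω v) ∈ closure (oc Ω)) {t : ℝ} (ht0 : -ε < t) (ht1 : t < 1 + ε) :
    ∃ q ∈ face Ω v, cmap Ω q = cmap Ω v + t • (y - cmap Ω v) := by
  have hv1 := cmap_one hΩ hv
  obtain ⟨a, ha, ha'⟩ := exists_of_cc h1 (by simp [hv1, hy])
  obtain ⟨b, hb, hb'⟩ := exists_of_cc h2 (by simp [hv1, hy])
  have hne : 1 + 2 * ε ≠ 0 := by positivity
  have par : ∀ τ : ℝ, cmap Ω v + τ • (y - cmap Ω v) = cmap Ω a + ((τ + ε) / (1 + 2 * ε)) • (cmap Ω b - cmap Ω a) := by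
    intro τ
    rw [ha', hb', show y + ε • (y - cmap Ω v) - (cmap Ω v + ε • (cmap Ω v - y)) = (1 + 2 * ε) • (y - cmap Ω v) by module,
      smul_smul, div_mul_cancel₀ _ hne]
    module
  have hq := cc_line hΩ (cmap_mem_cc hΩ ha) (cmap_mem_cc hΩ hb) (t := (t + ε) / (1 + 2 * ε))
    (div_nonneg (by linarith) (by linarith)) ((div_le_one (by linarith)).2 (by linarith))
  rw [← par] at hq
  obtain ⟨q, hq1, hq2⟩ := exists_of_cc hq (by simp [hv1, hy])
  refine ⟨q, Or.inr ⟨hq1, a, ha, b, hb, ⟨hv, ?_⟩, ⟨hq1, ?_⟩⟩, hq2⟩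
  · rw [mem_openSeg]
    refine ⟨(0 + ε) / (1 + 2 * ε), div_pos (by linarith) (by linarith), (div_lt_one (by linarith)).2 (by linarith), ?_⟩
    rw [← par]; simp
  · rw [mem_openSeg]
    refine ⟨(t + ε) / (1 + 2 * ε), div_pos (by linarith) (by linarith), (div_lt_one (by linarith)).2 (by linarith), ?_⟩
    rw [← par, hq2]

theorem shrink (hΩ : IsPCDomain Ω) {a b : Fin d → ℝ} (ha : a ∈ closure (oc Ω)) {ε δ : ℝ} (hε : 0 < ε)
    (h : a + ε • (a - b) ∈ closure (oc Ω)) (hδ : 0 ≤ δ) (hδε : δ ≤ ε) : a + δ • (a - b) ∈ closure (oc Ω) := by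
  have := cc_line hΩ ha h (t := δ / ε) (by positivity) ((div_le_one hε).2 hδε)
  convert this using 2
  rw [add_sub_cancel_left, smul_smul, div_mul_cancel₀ _ hε.ne']

theorem face_convex (hΩ : IsPCDomain Ω) {v : PSpace d} (hv : v ∈ closure Ω) :
    Convex ℝ (cmap Ω '' face Ω v) := by
  rintro _ ⟨x, hx, rfl⟩ _ ⟨y, hy, rfl⟩ a b ha hb hab
  have hC := ocone hΩ
  obtain ⟨ε₁, h1, h2, h3⟩ := face_eps hΩ hv hx
  obtain ⟨ε₂, h1', h2', h3'⟩ := face_eps hΩ hv hy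
  have hxc := face_sub hv hx
  have hyc := face_sub hv hy
  have hpos : 0 < min ε₁ ε₂ := lt_min h1 h1'
  replace h2 := shrink hΩ (cmap_mem_cc hΩ hv) h1 h2 hpos.le (min_le_left _ _)
  replace h3 := shrink hΩ (cmap_mem_cc hΩ hxc) h1 h3 hpos.le (min_le_left _ _)
  replace h2' := shrink hΩ (cmap_mem_cc hΩ hv) h1' h2' hpos.le (min_le_right _ _)
  replace h3' := shrink hΩ (cmap_mem_cc hΩ hyc) h1' h3' hpos.le (min_le_right _ _)
  obtain rfl : a = 1 - b := by linarith
  obtain ⟨q, hq, hq'⟩ := face_line hΩ hv (y := (1 - b) • cmap Ω x + b • cmap Ω y) (ε := min ε₁ ε₂)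
    (by simp [cmap_one hΩ hxc, cmap_one hΩ hyc]) hpos
    (by
      convert hC.cadd (hC.csmul ha h2) (hC.csmul hb h2') using 1
      module)
    (by
      convert hC.cadd (hC.csmul ha h3) (hC.csmul hb h3') using 1
      module) (t := 1) (by linarith) (by linarith)
  refine ⟨q, hq, ?_⟩
  rw [hq']; module

theorem face_pc (hΩ : IsPCDomain Ω) {v : PSpace d} (hv : v ∈ closure Ω) : IsProperlyConvex (face Ω v) := by
  refine ⟨chartOf Ω, ?_, face_convex hΩ hv, ?_⟩
  · intro x hx
    exact rep_ne hΩ (closure_minimal (face_sub hv) isClosed_closure hx)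
  · refine (chartOf_spec hΩ.2.2).2.2.closure.subset ?_
    rintro _ ⟨x, hx, rfl⟩
    exact cmap_mem_closure hΩ (face_sub hv hx)

theorem cmap_change (hΩ : IsPCDomain Ω) {x : PSpace d} (hx : x ∈ closure Ω) (φ : (Fin d → ℝ) →ₗ[ℝ] ℝ) :
    chartMap φ x = (φ (cmap Ω x))⁻¹ • cmap Ω x := by
  have h := chartMap_ne_zero _ (rep_ne hΩ hx)
  conv_lhs => rw [← mk_chartMap _ h]
  exact chartMap_mk _ _ _

theorem face_ne (hΩ : IsPCDomain Ω) {v x : PSpace d} (hv : v ∈ closure Ω) (hx : x ∈ face Ω v) :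
    chartOf (face Ω v) (cmap Ω x) ≠ 0 := by
  have h := chartMap_ne_zero _ (rep_ne hΩ (face_sub hv hx))
  have h2 := (chartOf_spec (face_pc hΩ hv)).1 x (subset_closure hx)
  conv at h2 => rw [← mk_chartMap _ h]
  exact (f_rep_mk_ne_zero _ _ _).1 h2

theorem face_sign (hΩ : IsPCDomain Ω) {v x y : PSpace d} (hv : v ∈ closure Ω) (hx : x ∈ face Ω v) (hy : y ∈ face Ω v) :
    0 < chartOf (face Ω v) (cmap Ω x) / chartOf (face Ω v) (cmap Ω y) := by
  set φ := chartOf (face Ω v)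
  have h1 : φ (cmap Ω x) ≠ 0 := face_ne hΩ hv hx
  have h2 : φ (cmap Ω y) ≠ 0 := face_ne hΩ hv hy
  by_contra hneg
  have h3 : 0 < -(φ (cmap Ω x) / φ (cmap Ω y)) := by
    have := div_ne_zero h1 h2
    rcases lt_or_gt_of_ne this with h | h
    · linarith
    · exact absurd h hneg
  set ρ := -(φ (cmap Ω x) / φ (cmap Ω y)) with hρ
  have hx' : φ (cmap Ω x) = -ρ * φ (cmap Ω y) := by rw [hρ]; field_simp
  obtain ⟨q, hq, hq'⟩ := face_convex hΩ hv ⟨x, hx, rfl⟩ ⟨y, hy, rfl⟩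
    (show 0 ≤ 1 / (1 + ρ) by positivity) (show 0 ≤ ρ / (1 + ρ) by positivity) (by field_simp)
  apply face_ne hΩ hv hq
  rw [hq', map_add, map_smul, map_smul]
  change _ • φ (cmap Ω x) + _ • φ (cmap Ω y) = 0
  rw [hx', smul_eq_mul, smul_eq_mul]
  field_simp
  ring

theorem face_dist (hΩ : IsPCDomain Ω) {v w : PSpace d} (hv : v ∈ closure Ω) (hw : w ∈ face Ω v) {r ε : ℝ}
    (hr : hilbertDist (face Ω v) v w ≤ r) (hε : 0 < ε) :
    ∃ α β : ℝ, 0 < α ∧ 0 < β ∧ α • cmap Ω w - cmap Ω v ∈ closure (oc Ω) ∧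
      β • cmap Ω v - cmap Ω w ∈ closure (oc Ω) ∧ α * β ≤ Real.exp (2 * (r + ε)) := by
  have hC := ocone hΩ
  have hvF : v ∈ face Ω v := Or.inl rfl
  have hwc := face_sub hv hw
  have hFs := chartOf_spec (face_pc hΩ hv)
  have sgn := fun x y hx hy => face_sign hΩ (x := x) (y := y) hv hx hy
  have fne := fun x hx => face_ne hΩ (x := x) hv hx
  have ch : ∀ x ∈ face Ω v, cmap (face Ω v) x = (chartOf (face Ω v) (cmap Ω x))⁻¹ • cmap Ω x :=
    fun x hx => cmap_change hΩ (face_sub hv hx) _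
  unfold hilbertDist hilbertDistChart at hr
  split_ifs at hr with hvw
  · have : v = w := by
      have hv0 := chartMap_ne_zero _ (hFs.1 v (subset_closure hvF))
      have hw0 := chartMap_ne_zero _ (hFs.1 w (subset_closure hw))
      rw [← mk_chartMap _ hv0, ← mk_chartMap _ hw0]
      congr 1
    subst this
    refine ⟨1, 1, one_pos, one_pos, ?_, ?_, ?_⟩
    · simpa using hC.zero_mem
    · simpa using hC.zero_mem
    · rw [one_mul]; exact Real.one_le_exp (by linarith)
  have bd := bdd_line hFs.2.2 hvw
  set T := {t : ℝ | cmap (face Ω v) v + t • (cmap (face Ω v) w - cmap (face Ω v) v) ∈ cmap (face Ω v) '' face Ω v} with hT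
  rw [ch v hvF, ch w hw] at hT
  set φ := chartOf (face Ω v) with hφ
  have hφv : φ (cmap Ω v) ≠ 0 := fne v hvF
  have hφw : φ (cmap Ω w) ≠ 0 := fne w hw
  have memT : ∀ t, t ∈ T → ∃ q ∈ face Ω v, (φ (cmap Ω q))⁻¹ • cmap Ω q =
      ((1 - t) * (φ (cmap Ω v))⁻¹) • cmap Ω v + (t * (φ (cmap Ω w))⁻¹) • cmap Ω w := by
    intro t ht
    rw [hT] at ht
    obtain ⟨q, hq, hq'⟩ := ht
    refine ⟨q, hq, ?_⟩
    rw [ch q hq] at hq'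
    rw [hq']; module
  -- points of the line
  obtain ⟨η, hη, hη1, hη2⟩ := face_eps hΩ hv hw
  have toT : ∀ τ : ℝ, -η < τ → τ < 1 + η → ∃ q ∈ face Ω v, 
      τ * (φ (cmap Ω w) / φ (cmap Ω q)) ∈ T ∧
      τ * (φ (cmap Ω w) / φ (cmap Ω q)) = 1 - (1 - τ) * (φ (cmap Ω v) / φ (cmap Ω q)) := by
    intro τ h1 h2
    obtain ⟨q, hq, hq'⟩ := face_line hΩ hv (cmap_one hΩ hwc) hη hη1 hη2 h1 h2
    have hφq : φ (cmap Ω q) ≠ 0 := fne q hq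
    have e1 : φ (cmap Ω q) = (1 - τ) * φ (cmap Ω v) + τ * φ (cmap Ω w) := by
      rw [hq', map_add, map_smul, map_sub, smul_eq_mul]; ring
    have e2 : τ * (φ (cmap Ω w) / φ (cmap Ω q)) = 1 - (1 - τ) * (φ (cmap Ω v) / φ (cmap Ω q)) := by
      field_simp
      rw [e1]; ring
    refine ⟨q, hq, ?_, e2⟩
    rw [hT]
    refine ⟨q, hq, ?_⟩
    rw [ch q hq]
    change (φ (cmap Ω q))⁻¹ • cmap Ω q = _
    rw [smul_sub, smul_smul, smul_smul]
    have e3 : τ * (φ (cmap Ω w) / φ (cmap Ω q)) * (φ (cmap Ω w))⁻¹ = (φ (cmap Ω q))⁻¹ * τ := by field_simp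
    have e4 : τ * (φ (cmap Ω w) / φ (cmap Ω q)) * (φ (cmap Ω v))⁻¹ = (φ (cmap Ω v))⁻¹ - (φ (cmap Ω q))⁻¹ * (1 - τ) := by
      rw [e2]; field_simp
    rw [e3, e4, hq']
    module
  have hsup : 1 < sSup T := by
    obtain ⟨q, hq, h1, h2⟩ := toT (1 + η / 2) (by linarith) (by linarith)
    refine lt_of_lt_of_le ?_ (le_csSup bd.bddAbove h1)
    rw [h2]
    have : 0 < φ (cmap Ω v) / φ (cmap Ω q) := sgn v q hvF hq
    nlinarith
  have hinf : sInf T < 0 := by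
    obtain ⟨q, hq, h1, h2⟩ := toT (-(η / 2)) (by linarith) (by linarith)
    refine lt_of_le_of_lt (csInf_le bd.bddBelow h1) ?_
    have : 0 < φ (cmap Ω w) / φ (cmap Ω q) := sgn w q hw hq
    nlinarith
  have hne : T.Nonempty := by
    obtain ⟨q, hq, h1, h2⟩ := toT 0 (by linarith) (by linarith)
    exact ⟨_, h1⟩
  set P := sSup T / (sSup T - 1) with hP
  set Q := (1 - sInf T) / (-sInf T) with hQ
  have e5 : (sSup T * (1 - sInf T)) / ((-(sInf T)) * (sSup T - 1)) = P * Q := by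
    rw [hP, hQ, div_mul_div_comm, mul_comm (-sInf T)]
  have hP1 : 1 < P := by rw [hP, one_lt_div (by linarith)]; linarith
  have hQ1 : 1 < Q := by rw [hQ, one_lt_div (by linarith)]; linarith
  have hPQ : P * Q ≤ Real.exp (2 * r) := by
    rw [e5] at hr
    rw [← Real.log_le_iff_le_exp (by positivity)]
    linarith
  have hE : 1 < Real.exp ε := Real.one_lt_exp_iff.2 hε
  have hPy : P < P * Real.exp ε := by nlinarith
  have hQy : Q < Q * Real.exp ε := by nlinarith
  obtain ⟨t, htT, ht1, ht⟩ : ∃ t ∈ T, 1 < t ∧ t / (t - 1) ≤ P * Real.exp ε := by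
    set y := P * Real.exp ε
    have hy1 : 1 < y := by linarith
    obtain ⟨t, ht, hct⟩ := exists_lt_of_lt_csSup hne (show y / (y - 1) < sSup T by
      rw [hP, div_lt_iff₀ (by linarith)] at hPy
      rw [div_lt_iff₀ (by linarith)]; linarith)
    have : 1 < t := lt_trans (by rw [one_lt_div (by linarith)]; linarith) hct
    refine ⟨t, ht, this, ?_⟩
    rw [div_lt_iff₀ (by linarith)] at hct
    rw [div_le_iff₀ (by linarith)]; linarith
  obtain ⟨s, hsT, hs0, hs⟩ : ∃ s ∈ T, s < 0 ∧ (1 - s) / (-s) ≤ Q * Real.exp ε := by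
    set y := Q * Real.exp ε
    have hy1 : 1 < y := by linarith
    obtain ⟨s, hs, hcs⟩ := exists_lt_of_csInf_lt hne (show sInf T < -(1 / (y - 1)) by
      rw [hQ, div_lt_iff₀ (by linarith)] at hQy
      rw [lt_neg, div_lt_iff₀ (by linarith)]; linarith)
    have h0 : 0 < 1 / (y - 1) := one_div_pos.2 (by linarith)
    have hs0 : s < 0 := by linarith
    refine ⟨s, hs, hs0, ?_⟩
    rw [lt_neg, div_lt_iff₀ (by linarith)] at hcs
    rw [div_le_iff₀ (by linarith)]; linarith
  obtain ⟨q1, hq1, hq1'⟩ := memT t htT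
  obtain ⟨q2, hq2, hq2'⟩ := memT s hsT
  have s1 : 0 < φ (cmap Ω v) / φ (cmap Ω q1) := sgn v q1 hvF hq1
  have s2 : 0 < φ (cmap Ω w) / φ (cmap Ω q2) := sgn w q2 hw hq2
  have s3 : 0 < φ (cmap Ω v) / φ (cmap Ω w) := sgn v w hvF hw
  have s4 : 0 < φ (cmap Ω w) / φ (cmap Ω v) := sgn w v hw hvF
  have ht' : 0 < t / (t - 1) := div_pos (by linarith) (by linarith)
  have hs' : 0 < (1 - s) / (-s) := div_pos (by linarith) (by linarith)
  refine ⟨t / (t - 1) * (φ (cmap Ω v) / φ (cmap Ω w)), (1 - s) / (-s) * (φ (cmap Ω w) / φ (cmap Ω v)),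
    mul_pos ht' s3, mul_pos hs' s4, ?_, ?_, ?_⟩
  · have h := hC.csmul (c := φ (cmap Ω v) / φ (cmap Ω q1) / (t - 1)) (div_pos s1 (by linarith)).le
      (cmap_mem_cc hΩ (face_sub hv hq1))
    have ht1' : t - 1 ≠ 0 := by linarith
    convert h using 1
    have h2 := congrArg (fun z => (φ (cmap Ω v) / (t - 1)) • z) hq1'
    simp only [smul_add, smul_smul] at h2
    rw [show φ (cmap Ω v) / φ (cmap Ω q1) / (t - 1) = φ (cmap Ω v) / (t - 1) * (φ (cmap Ω q1))⁻¹ by ring, h2,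
      show φ (cmap Ω v) / (t - 1) * ((1 - t) * (φ (cmap Ω v))⁻¹) = -1 by field_simp; ring,
      show φ (cmap Ω v) / (t - 1) * (t * (φ (cmap Ω w))⁻¹) = t / (t - 1) * (φ (cmap Ω v) / φ (cmap Ω w)) by ring]
    module
  · have h := hC.csmul (c := φ (cmap Ω w) / φ (cmap Ω q2) / (-s)) (div_pos s2 (by linarith)).le
      (cmap_mem_cc hΩ (face_sub hv hq2))
    have hs1' : s ≠ 0 := by linarith
    convert h using 1
    have h2 := congrArg (fun z => (φ (cmap Ω w) / (-s)) • z) hq2'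
    simp only [smul_add, smul_smul] at h2
    rw [show φ (cmap Ω w) / φ (cmap Ω q2) / (-s) = φ (cmap Ω w) / (-s) * (φ (cmap Ω q2))⁻¹ by ring, h2,
      show φ (cmap Ω w) / (-s) * (s * (φ (cmap Ω w))⁻¹) = -1 by field_simp,
      show φ (cmap Ω w) / (-s) * ((1 - s) * (φ (cmap Ω v))⁻¹) = (1 - s) / (-s) * (φ (cmap Ω w) / φ (cmap Ω v)) by ring]
    module
  · calc _ = (t / (t - 1)) * ((1 - s) / (-s)) := by field_simp
      _ ≤ (P * Real.exp ε) * (Q * Real.exp ε) := mul_le_mul ht hs hs'.le (by positivity)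
      _ = (P * Q) * Real.exp (2 * ε) := by rw [show 2 * ε = ε + ε by ring, Real.exp_add]; ring
      _ ≤ Real.exp (2 * r) * Real.exp (2 * ε) := by gcongr
      _ = _ := by rw [← Real.exp_add]; congr 1; ring
end PartD

section PartE
open Topology
variable {d : ℕ} {Ω : Set (PSpace d)}

theorem sum_single {p : ℕ} (hp : p ≤ d) (a : Fin p → ℝ) (i : Fin d) :
    (∑ j, a j • (Pi.single (Fin.castLE hp j) 1 : Fin d → ℝ)) i = if h : (i : ℕ) < p then a ⟨i, h⟩ else 0 := by
  rw [Finset.sum_apply]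
  split_ifs with h
  · rw [Finset.sum_eq_single ⟨i, h⟩]
    · simp [Fin.castLE]
    · intro b _ hb
      have : i ≠ Fin.castLE hp b := by
        rintro rfl; exact hb rfl
      simp [this]
    · simp
  · apply Finset.sum_eq_zero
    intro b _
    have : i ≠ Fin.castLE hp b := by
      rintro rfl; exact h b.2
    simp [this]

theorem simplex_iff {p : ℕ} (hp : p ≤ d) (g : (Fin d → ℝ) ≃ₗ[ℝ] (Fin d → ℝ)) (z : PSpace d) :
    (∃ v ∈ simplexCone (d := d) p, ∃ hv : v ≠ 0,
        z = Projectivization.mk ℝ (g v) (by simpa using hv)) ↔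
    ∃ a : Fin p → ℝ, (∀ j, 0 < a j) ∧ ∃ h : ∑ j, a j • g (Pi.single (Fin.castLE hp j) 1) ≠ 0,
      z = Projectivization.mk ℝ _ h := by
  have key : ∀ a : Fin p → ℝ, ∑ j, a j • g (Pi.single (Fin.castLE hp j) 1) =
      g (∑ j, a j • (Pi.single (Fin.castLE hp j) 1 : Fin d → ℝ)) := by
    intro a; simp [map_sum]
  constructor
  · rintro ⟨x, hx, hx0, rfl⟩
    have hxs : x = ∑ j, x (Fin.castLE hp j) • (Pi.single (Fin.castLE hp j) 1 : Fin d → ℝ) := by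
      ext i
      rw [sum_single]
      split_ifs with h
      · rfl
      · exact hx.2 i (by omega)
    have hg : ∑ j, x (Fin.castLE hp j) • g (Pi.single (Fin.castLE hp j) 1) = g x := by
      rw [key, ← hxs]
    refine ⟨fun j => x (Fin.castLE hp j), fun j => hx.1 _ j.2, ?_, ?_⟩
    · rw [hg]; simpa using hx0
    · congr 1; exact hg.symm
  · rintro ⟨a, ha, h, rfl⟩
    refine ⟨∑ j, a j • (Pi.single (Fin.castLE hp j) 1 : Fin d → ℝ), ⟨?_, ?_⟩, ?_, ?_⟩
    · intro i hi; rw [sum_single, dif_pos hi]; exact ha _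
    · intro i hi; rw [sum_single, dif_neg (by omega)]
    · intro h0; apply h; rw [key, h0, map_zero]
    · congr 1; exact key a

theorem mk_congr {x y : Fin d → ℝ} (hx : x ≠ 0) (hy : y ≠ 0) (c : ℝ) (h : x = c • y) :
    Projectivization.mk ℝ x hx = Projectivization.mk ℝ y hy := by
  subst h; exact mk_smul _ _ _ _

theorem same_sign {p : ℕ} (u : Fin p → ℝ) (h0 : ∀ j, u j ≠ 0)
    (h : ∀ a : Fin p → ℝ, (∀ j, 0 < a j) → 0 < p → ∑ j, a j * u j ≠ 0) :
    ∃ σ : ℝ, σ ≠ 0 ∧ ∀ j, 0 < σ * u j := by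
  by_cases hpos : ∀ j, 0 < u j
  · exact ⟨1, one_ne_zero, by simpa using hpos⟩
  by_cases hneg : ∀ j, u j < 0
  · exact ⟨-1, by norm_num, by simpa using hneg⟩
  push Not at hpos hneg
  obtain ⟨i, hi⟩ := hpos
  obtain ⟨j, hj⟩ := hneg
  have hi : u i < 0 := lt_of_le_of_ne hi (h0 i)
  have hj : 0 < u j := lt_of_le_of_ne hj (h0 j).symm
  have hp : 0 < p := i.pos
  have key : ∀ k (t : ℝ), ∑ l, (1 + (if l = k then t else 0)) * u l = ∑ l, u l + t * u k := by
    intro k t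
    simp [add_mul, Finset.sum_add_distrib]
  exfalso
  rcases le_or_gt 0 (∑ l, u l) with hs | hs
  · refine h (fun l => 1 + (if l = i then (∑ l, u l) / (-u i) else 0)) ?_ hp ?_
    · intro l
      have : 0 ≤ (∑ l, u l) / (-u i) := div_nonneg hs (by linarith)
      split_ifs <;> linarith
    · rw [key, div_mul_eq_mul_div, div_neg, mul_div_cancel_right₀ _ hi.ne]; ring
  · refine h (fun l => 1 + (if l = j then (-∑ l, u l) / (u j) else 0)) ?_ hp ?_
    · intro l
      have : 0 ≤ (-∑ l, u l) / (u j) := div_nonneg (by linarith) (by linarith)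
      split_ifs <;> linarith
    · rw [key]; field_simp; ring

theorem std {p : ℕ} (hΩ : IsPCDomain Ω) {S : Set (PSpace d)} {v : Fin p → PSpace d} (hS : HasVertices S v)
    (hSΩ : S ⊆ Ω) : (∀ j, v j ∈ closure Ω) ∧ LinearIndependent ℝ (fun j => cmap Ω (v j)) ∧
    ∀ z, z ∈ S ↔ ∃ a : Fin p → ℝ, (∀ j, 0 < a j) ∧ ∃ h : ∑ j, a j • cmap Ω (v j) ≠ 0,
      z = Projectivization.mk ℝ _ h := by
  obtain ⟨hp, g, hg, hv⟩ := hS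
  have hmem : ∀ z, z ∈ S ↔ ∃ a : Fin p → ℝ, (∀ j, 0 < a j) ∧
      ∃ h : ∑ j, a j • g (Pi.single (Fin.castLE hp j) 1) ≠ 0, z = Projectivization.mk ℝ _ h := fun z => by
    rw [← simplex_iff hp g z, hg]
    exact Iff.rfl
  set V : Fin p → Fin d → ℝ := fun j => g (Pi.single (Fin.castLE hp j) 1) with hVdef
  have hVli : LinearIndependent ℝ V := by
    have := (Pi.basisFun ℝ (Fin d)).linearIndependent.comp (Fin.castLE hp) (Fin.castLE_injective hp)
    have := this.map' g.toLinearMap (by simp)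
    have e : V = ⇑g.toLinearMap ∘ ⇑(Pi.basisFun ℝ (Fin d)) ∘ Fin.castLE hp := by
      ext1 j
      simp [V]
    rw [e]; exact this
  have hV0 : ∀ j, V j ≠ 0 := fun j => hVli.ne_zero j
  have hsum : ∀ a : Fin p → ℝ, (∀ j, 0 < a j) → 0 < p → ∑ j, a j • V j ≠ 0 := by
    intro a ha hp0 h0
    have := Fintype.linearIndependent_iff.1 hVli a h0 ⟨0, hp0⟩
    exact (ha _).ne' this
  have hvV : ∀ j, v j = Projectivization.mk ℝ (V j) (hV0 j) := hv
  have hvc : ∀ j, v j ∈ closure Ω := by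
    intro j
    rw [hvV]
    apply mk_mem_closure
    have h1 : Tendsto (fun c : ℝ => V j + c • ∑ k, V k) (𝓝[>] 0) (𝓝 (V j)) := by
      have : Tendsto (fun c : ℝ => V j + c • ∑ k, V k) (𝓝 0) (𝓝 (V j + (0 : ℝ) • ∑ k, V k)) :=
        (continuous_const.add (continuous_id.smul continuous_const)).tendsto 0
      rw [zero_smul, add_zero] at this
      exact this.mono_left nhdsWithin_le_nhds
    refine mem_closure_of_tendsto h1 ?_
    filter_upwards [self_mem_nhdsWithin] with c hc
    have hc : 0 < c := hc
    have e : V j + c • ∑ k, V k = ∑ k, ((if k = j then 1 else 0) + c) • V k := by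
      simp [add_smul, Finset.sum_add_distrib, Finset.smul_sum]
    have hpos : ∀ k, 0 < (if k = j then (1 : ℝ) else 0) + c := by
      intro k; split_ifs <;> linarith
    have hne := hsum _ hpos j.pos
    rw [e]
    exact ⟨hne, hSΩ ((hmem _).2 ⟨_, hpos, hne, rfl⟩)⟩
  have hf0 : ∀ j, chartOf Ω (V j) ≠ 0 := by
    intro j
    rw [← f_rep_mk_ne_zero _ _ (hV0 j), ← hvV]
    exact rep_ne hΩ (hvc j)
  obtain ⟨σ, hσ, hσ'⟩ := same_sign (fun j => chartOf Ω (V j)) hf0 (by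
    intro a ha hp0
    have hne := hsum a ha hp0
    have h1 : Projectivization.mk ℝ _ hne ∈ S := (hmem _).2 ⟨a, ha, hne, rfl⟩
    have h2 := rep_ne hΩ (subset_closure (hSΩ h1))
    rw [f_rep_mk_ne_zero] at h2
    simpa [map_sum] using h2)
  have hcv : ∀ j, cmap Ω (v j) = (chartOf Ω (V j))⁻¹ • V j := by
    intro j
    rw [hvV]; exact chartMap_mk _ _ _
  have conv : ∀ a : Fin p → ℝ, ∑ j, (a j * (σ * chartOf Ω (V j))) • cmap Ω (v j) = σ • ∑ j, a j • V j := by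
    intro a
    rw [Finset.smul_sum]
    refine Finset.sum_congr rfl fun j _ => ?_
    rw [hcv, smul_smul, smul_smul]
    congr 1
    have := hf0 j
    field_simp
  refine ⟨hvc, ?_, ?_⟩
  · have := hVli.units_smul (fun j => Units.mk0 (chartOf Ω (V j))⁻¹ (inv_ne_zero (hf0 j)))
    convert this using 1
    ext1 j
    exact hcv j
  · intro z
    rw [hmem]
    constructor
    · rintro ⟨a, ha, h, rfl⟩
      have hne : ∑ j, (a j * (σ * chartOf Ω (V j))) • cmap Ω (v j) ≠ 0 := by
        rw [conv]; exact smul_ne_zero hσ h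
      refine ⟨_, fun j => mul_pos (ha j) (hσ' j), hne, ?_⟩
      exact (mk_congr _ _ σ (conv a)).symm
    · rintro ⟨a, ha, h, rfl⟩
      have e : ∑ j, a j • cmap Ω (v j) = σ • ∑ j, (a j / (σ * chartOf Ω (V j))) • V j := by
        rw [← conv]
        refine Finset.sum_congr rfl fun j _ => ?_
        rw [div_mul_cancel₀ _ (hσ' j).ne']
      have hne : ∑ j, (a j / (σ * chartOf Ω (V j))) • V j ≠ 0 := by
        intro h0; rw [h0, smul_zero] at e; exact h e
      exact ⟨_, fun j => div_pos (ha j) (hσ' j), hne, mk_congr _ _ σ e⟩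

theorem pe_closed {A B : Set (PSpace d)} (h : IsProperlyEmbedded A B) : A ⊆ B ∧ closure A ∩ B ⊆ A := by
  obtain ⟨h, hp⟩ := h
  refine ⟨h, ?_⟩
  have hc := hp.isClosedMap.isClosed_range
  rintro x ⟨hx, hxB⟩
  have : (⟨x, hxB⟩ : B) ∈ closure (range (Set.inclusion h)) := by
    rw [closure_subtype]
    convert hx
    ext y
    constructor
    · rintro ⟨_, ⟨z, rfl⟩, rfl⟩; exact z.2
    · intro hy; exact ⟨_, ⟨⟨y, hy⟩, rfl⟩, rfl⟩
  rw [hc.closure_eq] at this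
  obtain ⟨z, hz⟩ := this
  have := congrArg Subtype.val hz
  simp at this
  rw [← this]; exact z.2

theorem pe_of_closed {A B K : Set (PSpace d)} (hK : IsClosed K) (hA : A = B ∩ K) : IsProperlyEmbedded A B := by
  have h : A ⊆ B := by rw [hA]; exact inter_subset_left
  refine ⟨h, IsClosedEmbedding.isProperMap ⟨Topology.IsEmbedding.inclusion h, ?_⟩⟩
  rw [Set.range_inclusion]
  convert hK.preimage (continuous_subtype_val : Continuous (Subtype.val : B → PSpace d)) using 1
  ext x
  simp only [hA]
  simp

theorem closed_span (W : Submodule ℝ (Fin d → ℝ)) : IsClosed {z : PSpace d | z.rep ∈ W} := by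
  rw [← (mk'_isOpenQuotientMap (d := d)).isQuotientMap.isClosed_preimage]
  have hW : IsClosed (W : Set (Fin d → ℝ)) := W.closed_of_finiteDimensional
  convert hW.preimage (continuous_subtype_val : Continuous (Subtype.val : {v : Fin d → ℝ // v ≠ 0} → _)) using 1
  ext x
  obtain ⟨a, ha⟩ := Projectivization.exists_smul_eq_mk_rep ℝ x.1 x.2
  simp only [mem_preimage, mem_ofPred_eq, SetLike.mem_coe]
  rw [← ha, Units.smul_def, Submodule.smul_mem_iff _ a.ne_zero]
end PartE

section PartF
open Topology
variable {d : ℕ} {Ω : Set (PSpace d)}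

theorem f_sum {p : ℕ} (hΩ : IsPCDomain Ω) {v : Fin p → PSpace d} (hv : ∀ j, v j ∈ closure Ω) (a : Fin p → ℝ) :
    chartOf Ω (∑ j, a j • cmap Ω (v j)) = ∑ j, a j := by
  rw [map_sum]
  refine Finset.sum_congr rfl fun j _ => ?_
  rw [map_smul, cmap_one hΩ (hv j), smul_eq_mul, mul_one]

theorem core_v {p : ℕ} (hp0 : 0 < p) (hΩ : IsPCDomain Ω) {S : Set (PSpace d)} {v : Fin p → PSpace d}
    (hvc : ∀ j, v j ∈ closure Ω) (hli : LinearIndependent ℝ (fun j => cmap Ω (v j)))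
    (hSΩ : S ⊆ Ω) (hcl : closure S ∩ Ω ⊆ S)
    (hmem : ∀ z, z ∈ S ↔ ∃ a : Fin p → ℝ, (∀ j, 0 < a j) ∧ ∃ h : ∑ j, a j • cmap Ω (v j) ≠ 0,
      z = Projectivization.mk ℝ _ h) :
    (∀ a : Fin p → ℝ, (∀ j, 0 < a j) → ∑ j, a j • cmap Ω (v j) ∈ oc Ω) ∧
    (∀ a : Fin p → ℝ, (∀ j, 0 ≤ a j) → ∑ j, a j • cmap Ω (v j) ∈ oc Ω → ∀ j, 0 < a j) := by
  have hsum : ∀ a : Fin p → ℝ, (∀ j, 0 < a j) → ∑ j, a j • cmap Ω (v j) ≠ 0 := by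
    intro a ha h0
    have := Fintype.linearIndependent_iff.1 hli a h0 ⟨0, hp0⟩
    exact (ha _).ne' this
  constructor
  · intro a ha
    refine ⟨?_, hsum a ha, hSΩ ((hmem _).2 ⟨a, ha, _, rfl⟩)⟩
    rw [mem_ofPred_eq, f_sum hΩ hvc]
    exact Finset.sum_pos (fun j _ => ha j) ⟨⟨0, hp0⟩, Finset.mem_univ _⟩
  · intro a ha hX j
    obtain ⟨-, hne, hXΩ⟩ := hX
    have hXS : Projectivization.mk ℝ _ hne ∈ S := by
      refine hcl ⟨?_, hXΩ⟩
      apply mk_mem_closure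
      have h1 : Tendsto (fun c : ℝ => ∑ k, (a k + c) • cmap Ω (v k)) (𝓝[>] 0)
          (𝓝 (∑ k, a k • cmap Ω (v k))) := by
        have hc : Continuous (fun c : ℝ => ∑ k, (a k + c) • cmap Ω (v k)) := by fun_prop
        have := hc.tendsto 0
        simp only [add_zero] at this
        exact this.mono_left nhdsWithin_le_nhds
      refine mem_closure_of_tendsto h1 ?_
      filter_upwards [self_mem_nhdsWithin] with c hc
      have hc : 0 < c := hc
      have hpos : ∀ k, 0 < a k + c := fun k => by linarith [ha k]
      exact ⟨hsum _ hpos, (hmem _).2 ⟨_, hpos, _, rfl⟩⟩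
    obtain ⟨b, hb, hb0, hab⟩ := (hmem _).1 hXS
    rw [Projectivization.mk_eq_mk_iff'] at hab
    obtain ⟨l, hl⟩ := hab
    have hl0 : l ≠ 0 := by
      rintro rfl; rw [zero_smul] at hl; exact hne hl.symm
    have h2 : ∑ k, (l * b k - a k) • cmap Ω (v k) = 0 := by
      simp only [sub_smul, Finset.sum_sub_distrib, mul_smul, ← Finset.smul_sum]
      rw [hl, sub_self]
    have h3 := fun k => Fintype.linearIndependent_iff.1 hli _ h2 k
    have h4 : a j = l * b j := by linarith [h3 j]
    rcases (ha j).eq_or_lt with h | h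
    · rw [h4] at h
      exact absurd h.symm (mul_ne_zero hl0 (hb j).ne')
    · exact h

theorem dist_le (hΩ : IsPCDomain Ω) {X Y : Fin d → ℝ} (hX : X ∈ oc Ω) (hY : Y ∈ oc Ω) (hX0 : X ≠ 0) (hY0 : Y ≠ 0)
    {M : ℝ} (h1 : Y - X ∈ closure (oc Ω)) (h2 : M • X - Y ∈ closure (oc Ω)) :
    hilbertDist Ω (Projectivization.mk ℝ X hX0) (Projectivization.mk ℝ Y hY0) ≤ 1 / 2 * Real.log M := by
  have hC := ocone hΩ
  have hfX : 0 < chartOf Ω X := hX.1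
  have hfY : 0 < chartOf Ω Y := hY.1
  unfold hilbertDist
  rw [show cmap Ω (Projectivization.mk ℝ X hX0) = (chartOf Ω X)⁻¹ • X from chartMap_mk _ _ _,
    show cmap Ω (Projectivization.mk ℝ Y hY0) = (chartOf Ω Y)⁻¹ • Y from chartMap_mk _ _ _]
  have := hilbert_le hΩ (mem_image_of_oc hX) (mem_image_of_oc hY)
    (α := chartOf Ω Y / chartOf Ω X) (β := M * chartOf Ω X / chartOf Ω Y) ?_ ?_
  · convert this using 3
    field_simp
  · have h := hC.csmul (inv_nonneg.2 hfX.le) h1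
    convert h using 1
    rw [smul_smul, smul_sub]
    congr 2
    field_simp
  · have h := hC.csmul (inv_nonneg.2 hfY.le) h2
    convert h using 1
    rw [smul_smul, smul_sub, smul_smul]
    congr 2
    field_simp

theorem span_eq {p : ℕ} (hΩ : IsPCDomain Ω) {w : Fin p → PSpace d} (hw : ∀ j, w j ∈ closure Ω) :
    Submodule.span ℝ (Set.range fun j => (w j).rep) = Submodule.span ℝ (Set.range fun j => cmap Ω (w j)) := by
  apply le_antisymm
  · rw [Submodule.span_le]
    rintro _ ⟨j, rfl⟩
    have h : (w j).rep = chartOf Ω (w j).rep • cmap Ω (w j) := by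
      unfold cmap chartMap
      rw [smul_smul, mul_inv_cancel₀ (rep_ne hΩ (hw j)), one_smul]
    simp only
    rw [h]
    exact Submodule.smul_mem _ _ (Submodule.subset_span ⟨j, rfl⟩)
  · rw [Submodule.span_le]
    rintro _ ⟨j, rfl⟩
    exact Submodule.smul_mem _ _ (Submodule.subset_span ⟨j, rfl⟩)

theorem main_aux {p : ℕ} (Ω : Set (PSpace d)) (hΩ : IsPCDomain Ω)
    (S : Set (PSpace d)) (v : Fin p → PSpace d)
    (hS : HasVertices S v) (hSpe : IsProperlyEmbedded S Ω)
    (w : Fin p → PSpace d) (hw : ∀ j, w j ∈ face Ω (v j)) :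
    LinearIndependent ℝ (fun j => cmap Ω (w j)) ∧ (0 < p → ∀ c : Fin p → ℝ,
      ∑ j, c j • cmap Ω (w j) ∈ oc Ω ↔ ∀ j, 0 < c j) := by
  obtain ⟨hSΩ, hcl⟩ := pe_closed hSpe
  obtain ⟨hvc, hli, hmem⟩ := std hΩ hS hSΩ
  have hwc : ∀ j, w j ∈ closure Ω := fun j => face_sub (hvc j) (hw j)
  have h2 : 0 < p → ∀ c : Fin p → ℝ, ∑ j, c j • cmap Ω (w j) ∈ oc Ω ↔ ∀ j, 0 < c j := by
    intro hp0 c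
    obtain ⟨H2, H1⟩ := core_v hp0 hΩ hvc hli hSΩ hcl hmem
    constructor
    · intro hc
      refine (ocone hΩ).sum_mem_iff (fun j => cmap_mem_cc hΩ (hwc j)) H1 (fun j => ?_) hc
      obtain ⟨α, β, hα, hβ, h1, h2, -⟩ := face_dist hΩ (hvc j) (hw j) le_rfl one_pos
      exact ⟨β, hβ, h2⟩
    · intro hc
      refine (ocone hΩ).sum_mem H2 (fun j => ?_) c hc
      obtain ⟨α, β, hα, hβ, h1, h2, -⟩ := face_dist hΩ (hvc j) (hw j) le_rfl one_pos
      exact ⟨α, hα, h1⟩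
  refine ⟨?_, h2⟩
  rcases Nat.eq_zero_or_pos p with rfl | hp0
  · exact linearIndependent_empty_type
  · exact OCone.li_of (h2 hp0)

theorem slide_main {p : ℕ} (Ω : Set (PSpace d)) (hΩ : IsPCDomain Ω)
    (S : Set (PSpace d)) (v : Fin p → PSpace d)
    (hS : HasVertices S v) (hSpe : IsProperlyEmbedded S Ω)
    (w : Fin p → PSpace d) (hw : ∀ j, w j ∈ face Ω (v j))
    (S' : Set (PSpace d))
    (hS' : S' = {z ∈ Ω | z.rep ∈ Submodule.span ℝ (Set.range fun j => (w j).rep)}) :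
    HasVertices S' w ∧ IsProperlyEmbedded S' Ω ∧
    cmap Ω '' S' = intrinsicInterior ℝ (convexHull ℝ (Set.range fun j => cmap Ω (w j))) ∧
    ∀ r : ℝ, (∀ j, hilbertDist (face Ω (v j)) (v j) (w j) ≤ r) →
      hausdorffDistLE Ω S S' r := by
  obtain ⟨hwli, hwoc⟩ := main_aux Ω hΩ S v hS hSpe w hw
  obtain ⟨hSΩ, hcl⟩ := pe_closed hSpe
  obtain ⟨hvc, hli, hmem⟩ := std hΩ hS hSΩ
  have hwc : ∀ j, w j ∈ closure Ω := fun j => face_sub (hvc j) (hw j)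
  have hC := ocone hΩ
  have hpos : ∀ {u : Fin p → PSpace d} {a : Fin p → ℝ}, ∑ j, a j • cmap Ω (u j) ≠ 0 → 0 < p := by
    intro u a h
    rcases Nat.eq_zero_or_pos p with rfl | hp0
    · simp at h
    · exact hp0
  have hmem' : ∀ z, z ∈ S' ↔ ∃ a : Fin p → ℝ, (∀ j, 0 < a j) ∧ ∃ h : ∑ j, a j • cmap Ω (w j) ≠ 0,
      z = Projectivization.mk ℝ _ h := by
    intro z
    rw [hS', span_eq hΩ hwc]
    constructor
    · rintro ⟨hz, hzs⟩
      have hzs' : cmap Ω z ∈ Submodule.span ℝ (Set.range fun j => cmap Ω (w j)) :=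
        Submodule.smul_mem _ _ hzs
      rw [Submodule.mem_span_range_iff_exists_fun] at hzs'
      obtain ⟨c, hc⟩ := hzs'
      have hne : cmap Ω z ≠ 0 := chartMap_ne_zero _ (rep_ne hΩ (subset_closure hz))
      have hne' : ∑ j, c j • cmap Ω (w j) ≠ 0 := by rw [hc]; exact hne
      have hoc : ∑ j, c j • cmap Ω (w j) ∈ oc Ω := by rw [hc]; exact mem_oc_of_mem hΩ hz
      refine ⟨c, (hwoc (hpos hne') c).1 hoc, hne', ?_⟩
      have h1 : Projectivization.mk ℝ _ hne = z := mk_chartMap _ _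
      conv_lhs => rw [← h1]
      congr 1; exact hc.symm
    · rintro ⟨a, ha, h, rfl⟩
      obtain ⟨-, h1, h2⟩ := (hwoc (hpos h) a).2 ha
      refine ⟨h2, ?_⟩
      obtain ⟨t, ht⟩ := Projectivization.exists_smul_eq_mk_rep ℝ _ h
      rw [← ht, Units.smul_def]
      exact Submodule.smul_mem _ _ (Submodule.sum_mem _ fun j _ =>
        Submodule.smul_mem _ _ (Submodule.subset_span ⟨j, rfl⟩))
  refine ⟨?_, ?_, ?_, ?_⟩
  · obtain ⟨hp, -⟩ := hS
    obtain ⟨g, hg⟩ := exists_equiv hp _ hwli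
    refine ⟨hp, g, ?_, ?_⟩
    · ext z
      rw [hmem']
      refine Iff.trans ?_ (simplex_iff hp g z).symm
      simp only [hg]
    · intro j
      have hne : cmap Ω (w j) ≠ 0 := chartMap_ne_zero _ (rep_ne hΩ (hwc j))
      have h1 : Projectivization.mk ℝ _ hne = w j := mk_chartMap _ _
      conv_lhs => rw [← h1]
      congr 1; exact (hg j).symm
  · exact pe_of_closed (closed_span (Submodule.span ℝ (Set.range fun j => (w j).rep))) hS'
  · rw [intrinsicInterior_simplex _ hwli]
    ext x
    constructor
    · rintro ⟨z, hz, rfl⟩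
      obtain ⟨a, ha, h, rfl⟩ := (hmem' _).1 hz
      have hp0 := hpos h
      have hs : 0 < ∑ j, a j := Finset.sum_pos (fun j _ => ha j) ⟨⟨0, hp0⟩, Finset.mem_univ _⟩
      refine ⟨fun j => (∑ j, a j)⁻¹ * a j, fun j => mul_pos (inv_pos.2 hs) (ha j), ?_, ?_⟩
      · rw [← Finset.mul_sum, inv_mul_cancel₀ hs.ne']
      · rw [show cmap Ω (Projectivization.mk ℝ _ h) = _ from chartMap_mk _ _ _, f_sum hΩ hwc, Finset.smul_sum]
        simp only [smul_smul]
    · rintro ⟨a, ha, h1, rfl⟩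
      have hne : ∑ j, a j • cmap Ω (w j) ≠ 0 := by
        intro h0
        have := f_sum hΩ hwc a
        rw [h0, map_zero, h1] at this
        exact zero_ne_one this
      refine ⟨Projectivization.mk ℝ _ hne, (hmem' _).2 ⟨a, ha, hne, rfl⟩, ?_⟩
      rw [show cmap Ω (Projectivization.mk ℝ _ hne) = _ from chartMap_mk _ _ _, f_sum hΩ hwc, h1, inv_one, one_smul]
  · intro r hr ε hε
    have hfd := fun j => face_dist hΩ (hvc j) (hw j) (hr j) (half_pos hε)
    choose α β hα hβ h1 h2 hM using hfd
    have key : ∀ a : Fin p → ℝ, (∀ j, 0 < a j) → ∀ (hX : ∑ j, a j • cmap Ω (v j) ≠ 0)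
        (hY : ∑ j, (a j * α j) • cmap Ω (w j) ≠ 0),
        hilbertDist Ω (Projectivization.mk ℝ _ hX) (Projectivization.mk ℝ _ hY) < r + ε := by
      intro a ha hX hY
      have hp0 := hpos hX
      obtain ⟨H2, H1⟩ := core_v hp0 hΩ hvc hli hSΩ hcl hmem
      have := dist_le hΩ (H2 a ha) ((hwoc hp0 _).2 (fun j => mul_pos (ha j) (hα j))) hX hY
        (M := Real.exp (2 * (r + ε / 2))) ?_ ?_
      · rw [Real.log_exp] at this
        linarith
      · rw [← Finset.sum_sub_distrib]
        refine hC.csum _ _ fun j _ => ?_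
        have := hC.csmul (ha j).le (h1 j)
        rwa [smul_sub, smul_smul] at this
      · rw [Finset.smul_sum, ← Finset.sum_sub_distrib]
        refine hC.csum _ _ fun j _ => ?_
        have i1 := hC.csmul (mul_pos (ha j) (hα j)).le (h2 j)
        have i2 := hC.csmul (mul_nonneg (ha j).le (sub_nonneg.2 (hM j))) (cmap_mem_cc hΩ (hvc j))
        convert hC.cadd i1 i2 using 1
        module
    constructor
    · intro x hx
      obtain ⟨a, ha, h, rfl⟩ := (hmem _).1 hx
      have hoc := (hwoc (hpos h) _).2 (fun j => mul_pos (ha j) (hα j))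
      obtain ⟨-, hne, -⟩ := id hoc
      exact ⟨_, (hmem' _).2 ⟨_, fun j => mul_pos (ha j) (hα j), hne, rfl⟩, key a ha h hne⟩
    · intro y hy
      obtain ⟨b, hb, h, rfl⟩ := (hmem' _).1 hy
      have ha : ∀ j, 0 < b j / α j := fun j => div_pos (hb j) (hα j)
      have hoc := (core_v (hpos h) hΩ hvc hli hSΩ hcl hmem).1 _ ha
      obtain ⟨-, hne, -⟩ := id hoc
      have e : ∀ j, b j / α j * α j = b j := fun j => div_mul_cancel₀ _ (hα j).ne'
      have := key _ ha hne
      simp only [e] at this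
      exact ⟨_, (hmem _).2 ⟨_, ha, hne, rfl⟩, this h⟩
end PartF

/-- Lemma 2.10: wiggling the vertices of a properly embedded simplex inside
the faces of its vertices gives a parallel properly embedded simplex, at Hausdorff distance
at most the maximum of the Hilbert distances moved in each face. -/
theorem slide_along_faces {d p : ℕ} (Ω : Set (PSpace d)) (hΩ : IsPCDomain Ω)
    (S : Set (PSpace d)) (v : Fin p → PSpace d)
    (hS : HasVertices S v) (hSpe : IsProperlyEmbedded S Ω)
    (w : Fin p → PSpace d) (hw : ∀ j, w j ∈ face Ω (v j))
    (S' : Set (PSpace d))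
    (hS' : S' = {z ∈ Ω | z.rep ∈ Submodule.span ℝ (Set.range fun j => (w j).rep)}) :
    HasVertices S' w ∧ IsProperlyEmbedded S' Ω ∧
    cmap Ω '' S' = intrinsicInterior ℝ (convexHull ℝ (Set.range fun j => cmap Ω (w j))) ∧
    ∀ r : ℝ, (∀ j, hilbertDist (face Ω (v j)) (v j) (w j) ≤ r) →
      hausdorffDistLE Ω S S' r := by
  exact slide_main Ω hΩ S v hS hSpe w hw S' hS'

end Paper
end
end

section
/- Let Ω ⊂ P(ℝ^d) be a properly convex domain with Hilbert metric d_Ω. Then the set of properly embedded simplices in Ω of dimension at least two is closed in the local Hausdorff topology on closed subsets of (Ω, d_Ω): if a sequence of properly embedded simplices of dimension at least two converges in the local Hausdorff topology to a nonempty closed set C, then C is a properly embedded simplex in Ω of dimension at least two. -/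
open Set Filter

noncomputable section

namespace Paper

variable {d : ℕ}

open Topology

/-- the cone over a subset of projective space -/
def cone (A : Set (PSpace d)) : Set (Fin d → ℝ) :=
  {v | ∃ h : v ≠ 0, Projectivization.mk ℝ v h ∈ A}

lemma cone_open {A : Set (PSpace d)} (hA : IsOpen A) : IsOpen (cone A) := by
  have hc : Continuous (fun v : {v : Fin d → ℝ // v ≠ 0} =>
      (Projectivization.mk ℝ v.1 v.2 : PSpace d)) := continuous_quotient_mk'
  have h1 : IsOpen ((fun v : {v : Fin d → ℝ // v ≠ 0} =>
      (Projectivization.mk ℝ v.1 v.2 : PSpace d)) ⁻¹' A) := hA.preimage hc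
  have h2 : IsOpen {v : Fin d → ℝ | v ≠ 0} := isOpen_ne
  have h3 := h2.isOpenMap_subtype_val _ h1
  convert h3 using 1
  ext v
  simp [cone]

lemma cone_closure {ι : Type*} {l : Filter ι} [l.NeBot] {A : Set (PSpace d)} {s : ι → Fin d → ℝ}
    {v : Fin d → ℝ} (hs : Tendsto s l (𝓝 v)) (hA : ∀ᶠ i in l, s i ∈ cone A) (hv : v ≠ 0) :
    v ∈ cone (closure A) := by
  refine ⟨hv, ?_⟩
  rw [mem_closure_iff]
  intro W hW hvW
  have h1 : ∀ᶠ i in l, s i ∈ cone W := hs ((cone_open hW).mem_nhds ⟨hv, hvW⟩)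
  obtain ⟨i, ⟨h, hi⟩, ⟨h', hi'⟩⟩ := (h1.and hA).exists
  exact ⟨_, hi, hi'⟩

lemma cone_smul {A : Set (PSpace d)} {v : Fin d → ℝ} {c : ℝ} (hc : c ≠ 0) (hv : v ∈ cone A) :
    c • v ∈ cone A := by
  obtain ⟨h, hv⟩ := hv
  refine ⟨smul_ne_zero hc h, ?_⟩
  convert hv using 1
  rw [Projectivization.mk_eq_mk_iff']
  exact ⟨c, rfl⟩

lemma rep_cone {A : Set (PSpace d)} {x : PSpace d} (hx : x ∈ A) : x.rep ∈ cone A :=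
  ⟨x.rep_nonzero, by rwa [Projectivization.mk_rep]⟩

lemma mk_chart {f : (Fin d → ℝ) →ₗ[ℝ] ℝ} {v : Fin d → ℝ} (h : v ≠ 0) (hf : f v ≠ 0) :
    chartMap f (Projectivization.mk ℝ v h) = (f v)⁻¹ • v := by
  obtain ⟨a, ha⟩ := Projectivization.exists_smul_eq_mk_rep ℝ v h
  have ha0 : (a : ℝ) ≠ 0 := a.ne_zero
  have ha' : (a : ℝ) • v = (Projectivization.mk ℝ v h).rep := ha
  rw [chartMap, ← ha', map_smul, smul_smul]
  congr 1
  simp only [smul_eq_mul]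
  field_simp

lemma chart_mem {f : (Fin d → ℝ) →ₗ[ℝ] ℝ} {A : Set (PSpace d)} (hf : ∀ x ∈ A, f x.rep ≠ 0)
    {v : Fin d → ℝ} : v ∈ chartMap f '' A ↔ f v = 1 ∧ v ∈ cone A := by
  constructor
  · rintro ⟨x, hx, rfl⟩
    have := hf x hx
    exact ⟨by simp [chartMap, this], cone_smul (inv_ne_zero this) (rep_cone hx)⟩
  · rintro ⟨h1, h, hv⟩
    exact ⟨_, hv, by rw [mk_chart h (by simp [h1]), h1]; simp⟩

lemma cone_f_ne {f : (Fin d → ℝ) →ₗ[ℝ] ℝ} {A : Set (PSpace d)} (hf : ∀ x ∈ A, f x.rep ≠ 0)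
    {v : Fin d → ℝ} (hv : v ∈ cone A) : f v ≠ 0 := by
  obtain ⟨h, hv⟩ := hv
  obtain ⟨a, ha⟩ := Projectivization.exists_smul_eq_mk_rep ℝ v h
  have ha' : (a : ℝ) • v = (Projectivization.mk ℝ v h).rep := ha
  have := hf _ hv
  rw [← ha', map_smul] at this
  intro h0
  simp [h0] at this

/-- relatively open in the hyperplane f=1 -/
def RelOpen (f : (Fin d → ℝ) →ₗ[ℝ] ℝ) (O : Set (Fin d → ℝ)) : Prop :=
  (∀ v ∈ O, f v = 1) ∧ ∀ v ∈ O, ∃ ρ > 0, ∀ z, f z = 1 → ‖z - v‖ < ρ → z ∈ O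

lemma T_small {f : (Fin d → ℝ) →ₗ[ℝ] ℝ} {O : Set (Fin d → ℝ)} (hO : RelOpen f O)
    {u v z : Fin d → ℝ} (hu : u ∈ O) (hv : v ∈ O) (hz : z ∈ O) :
    ∃ η > 0, ∀ t : ℝ, |t| ≤ η → z + t • (v - u) ∈ O := by
  obtain ⟨ρ, hρ, h⟩ := hO.2 z hz
  have hp : 0 < ‖v - u‖ + 1 := by positivity
  refine ⟨ρ / (‖v - u‖ + 1) / 2, by positivity, fun t ht => h _ ?_ ?_⟩
  · simp [hO.1 _ hu, hO.1 _ hv, hO.1 _ hz]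
  · rw [add_sub_cancel_left, norm_smul, Real.norm_eq_abs]
    calc |t| * ‖v - u‖ ≤ (ρ / (‖v - u‖ + 1) / 2) * (‖v - u‖ + 1) := by
          gcongr; linarith
      _ = ρ / 2 := by field_simp
      _ < ρ := by linarith

lemma T_facts {f : (Fin d → ℝ) →ₗ[ℝ] ℝ} {O : Set (Fin d → ℝ)} (hO : RelOpen f O) {D : ℝ}
    (hD : ∀ p ∈ O, ∀ q ∈ O, ‖p - q‖ ≤ D)
    {u v : Fin d → ℝ} (hu : u ∈ O) (hv : v ∈ O) (huv : u ≠ v) :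
    (∀ t ∈ {t : ℝ | u + t • (v - u) ∈ O}, |t| * ‖v - u‖ ≤ D) ∧
    BddAbove {t : ℝ | u + t • (v - u) ∈ O} ∧ BddBelow {t : ℝ | u + t • (v - u) ∈ O} ∧
    1 < sSup {t : ℝ | u + t • (v - u) ∈ O} ∧ sInf {t : ℝ | u + t • (v - u) ∈ O} < 0 := by
  have hδ : 0 < ‖v - u‖ := norm_pos_iff.2 (sub_ne_zero.2 huv.symm)
  have h1 : ∀ t ∈ {t : ℝ | u + t • (v - u) ∈ O}, |t| * ‖v - u‖ ≤ D := by
    intro t ht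
    have := hD _ ht _ hu
    rwa [add_sub_cancel_left, norm_smul, Real.norm_eq_abs] at this
  have ha : BddAbove {t : ℝ | u + t • (v - u) ∈ O} := by
    refine ⟨D / ‖v - u‖, fun t ht => ?_⟩
    rw [le_div_iff₀ hδ]
    exact le_trans (by gcongr; exact le_abs_self t) (h1 t ht)
  have hb : BddBelow {t : ℝ | u + t • (v - u) ∈ O} := by
    refine ⟨-(D / ‖v - u‖), fun t ht => ?_⟩
    rw [neg_le, le_div_iff₀ hδ]
    exact le_trans (by gcongr; exact neg_le_abs t) (h1 t ht)
  refine ⟨h1, ha, hb, ?_, ?_⟩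
  · obtain ⟨η, hη, h⟩ := T_small hO hu hv hv
    refine lt_of_lt_of_le (show 1 < 1 + η by linarith) (le_csSup ha ?_)
    have := h η (by rw [abs_of_pos hη])
    have e : u + (1 + η) • (v - u) = v + η • (v - u) := by module
    simpa [e] using this
  · obtain ⟨η, hη, h⟩ := T_small hO hu hv hu
    refine lt_of_le_of_lt (csInf_le hb (a := -η) ?_) (by linarith)
    exact h (-η) (by rw [abs_neg, abs_of_pos hη])

lemma hilbert_lower {f : (Fin d → ℝ) →ₗ[ℝ] ℝ} {O : Set (Fin d → ℝ)} (hO : RelOpen f O) {D : ℝ}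
    (hD : ∀ p ∈ O, ∀ q ∈ O, ‖p - q‖ ≤ D) (hD0 : 0 < D)
    {u v : Fin d → ℝ} (hu : u ∈ O) (hv : v ∈ O) :
    ‖v - u‖ ≤ D * (Real.exp (2 * hilbertDistChart O u v) - 1) := by
  by_cases huv : u = v
  · simp [hilbertDistChart, huv]
  obtain ⟨h1, ha, hb, hp, hm⟩ := T_facts hO hD hu hv huv
  have hδ : 0 < ‖v - u‖ := norm_pos_iff.2 (sub_ne_zero.2 (Ne.symm huv))
  rw [hilbertDistChart, if_neg huv]
  have hm2 : -(D / ‖v - u‖) ≤ sInf {t : ℝ | u + t • (v - u) ∈ O} := by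
    refine le_csInf ⟨0, by simpa using hu⟩ fun t ht => ?_
    rw [neg_le, le_div_iff₀ hδ]
    exact le_trans (by gcongr; exact neg_le_abs t) (h1 t ht)
  generalize sSup {t : ℝ | u + t • (v - u) ∈ O} = P at *
  generalize sInf {t : ℝ | u + t • (v - u) ∈ O} = m at *
  have e1 : P * (1 - m) / (-m * (P - 1)) = (P / (P - 1)) * ((1 - m) / (-m)) := by
    rw [div_mul_div_comm, mul_comm (-m)]
  have hP : 1 ≤ P / (P - 1) := by rw [le_div_iff₀ (by linarith)]; linarith
  have hM : 1 + ‖v - u‖ / D ≤ (1 - m) / (-m) := by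
    rw [le_div_iff₀ (by linarith)]
    have : -m * ‖v - u‖ ≤ D := by
      rw [← le_div_iff₀ hδ]; linarith
    have : ‖v - u‖ / D * -m ≤ 1 := by
      rw [div_mul_eq_mul_div, div_le_one hD0]; linarith
    linarith
  have h0 : 0 ≤ ‖v - u‖ / D := by positivity
  have hR : 1 + ‖v - u‖ / D ≤ P * (1 - m) / (-m * (P - 1)) := by
    rw [e1]; nlinarith
  rw [show ∀ x : ℝ, 2 * (1 / 2 * x) = x by intro x; ring, Real.exp_log (by linarith)]
  have : D * (‖v - u‖ / D) = ‖v - u‖ := by field_simp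
  nlinarith

lemma hilbert_upper {f : (Fin d → ℝ) →ₗ[ℝ] ℝ} {O : Set (Fin d → ℝ)} (hO : RelOpen f O) {D : ℝ}
    (hD : ∀ p ∈ O, ∀ q ∈ O, ‖p - q‖ ≤ D) {u : Fin d → ℝ} (hu : u ∈ O) :
    ∃ δ > 0, ∀ v ∈ O, ‖v - u‖ < δ → hilbertDistChart O u v < 2 := by
  obtain ⟨ρ, hρ, h⟩ := hO.2 u hu
  refine ⟨ρ / 3, by positivity, fun v hv hvu => ?_⟩
  by_cases huv : u = v
  · simp [hilbertDistChart, huv]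
  obtain ⟨h1, ha, hb, hp, hm⟩ := T_facts hO hD hu hv huv
  have hT : ∀ t : ℝ, |t| = 2 → u + t • (v - u) ∈ O := by
    intro t ht
    refine h _ (by simp [hO.1 _ hu, hO.1 _ hv]) ?_
    rw [add_sub_cancel_left, norm_smul, Real.norm_eq_abs, ht]; linarith
  have hp2 := le_csSup ha (hT 2 (by norm_num))
  have hm2 := csInf_le hb (hT (-2) (by norm_num))
  rw [hilbertDistChart, if_neg huv]
  generalize sSup {t : ℝ | u + t • (v - u) ∈ O} = P at *
  generalize sInf {t : ℝ | u + t • (v - u) ∈ O} = m at *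
  have hpos : 0 < -m * (P - 1) := mul_pos (by linarith) (by linarith)
  have hR : P * (1 - m) / (-m * (P - 1)) ≤ 3 := by
    rw [div_le_iff₀ hpos]; nlinarith
  have hR0 : 0 < P * (1 - m) / (-m * (P - 1)) :=
    div_pos (mul_pos (by linarith) (by linarith)) hpos
  have := Real.log_le_sub_one_of_pos hR0
  linarith

lemma convex_push {f : (Fin d → ℝ) →ₗ[ℝ] ℝ} {O : Set (Fin d → ℝ)} (hO : RelOpen f O)
    (hc : Convex ℝ O) {x z : Fin d → ℝ} (hx : x ∈ O) (hz : z ∈ closure O) (hfz : f z = 1) {t : ℝ}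
    (ht0 : 0 ≤ t) (ht : t < 1) : (1 - t) • x + t • z ∈ O := by
  obtain ⟨ρ, hρ, h⟩ := hO.2 x hx
  have h1 : 0 < 1 - t := by linarith
  obtain ⟨z', hz', hd⟩ := Metric.mem_closure_iff.1 hz (ρ * (1 - t)) (by positivity)
  have hx' : x + (t / (1 - t)) • (z - z') ∈ O := by
    refine h _ (by simp [hO.1 _ hx, hO.1 _ hz', hfz]) ?_
    rw [add_sub_cancel_left, norm_smul, Real.norm_eq_abs, abs_of_nonneg (by positivity)]
    rw [dist_eq_norm] at hd
    rw [div_mul_eq_mul_div, div_lt_iff₀ h1]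
    nlinarith [norm_nonneg (z - z')]
  have := hc hx' hz' h1.le ht0 (by ring)
  convert this using 1
  rw [smul_add, smul_smul, mul_div_cancel₀ _ h1.ne']
  module

/-- extension by zero -/
def extZ (m d : ℕ) : (Fin m → ℝ) →ₗ[ℝ] (Fin d → ℝ) where
  toFun a j := if h : j.1 < m then a ⟨j, h⟩ else 0
  map_add' a b := by ext j; by_cases h : j.1 < m <;> simp [h]
  map_smul' a b := by ext j; by_cases h : j.1 < m <;> simp [h]

lemma extZ_inj {m d : ℕ} (h : m ≤ d) : Function.Injective (extZ m d) := by
  intro a b hab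
  ext i
  have := congrFun hab (Fin.castLE h i)
  simpa [extZ] using this

lemma mem_simplexCone {m : ℕ} (h : m ≤ d) (v : Fin d → ℝ) :
    v ∈ simplexCone (d := d) m ↔ ∃ a : Fin m → ℝ, (∀ i, 0 < a i) ∧ v = extZ m d a := by
  constructor
  · rintro ⟨h1, h2⟩
    refine ⟨fun i => v (Fin.castLE h i), fun i => h1 _ (by simp), ?_⟩
    ext j
    by_cases hj : j.1 < m
    · simp [extZ, hj]
    · simp [extZ, hj, h2 j (by omega)]
  · rintro ⟨a, ha, rfl⟩
    refine ⟨fun i hi => ?_, fun i hi => ?_⟩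
    · simp [extZ, hi, ha]
    · simp [extZ, hi]

/-- the simplex spanned by a linear map -/
def IsSpx {k : ℕ} (L : (Fin (k + 1) → ℝ) →ₗ[ℝ] (Fin d → ℝ)) (S : Set (PSpace d)) : Prop :=
  ∀ q, q ∈ S ↔ ∃ a : Fin (k + 1) → ℝ, (∀ i, 0 < a i) ∧ ∃ h : L a ≠ 0, q = Projectivization.mk ℝ (L a) h

lemma spx_of {k : ℕ} {S : Set (PSpace d)} (h : IsSimplexOfDim k S) :
    ∃ L : (Fin (k + 1) → ℝ) →ₗ[ℝ] (Fin d → ℝ), Function.Injective L ∧ IsSpx L S := by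
  obtain ⟨hk, g, hg⟩ := h
  refine ⟨g.toLinearMap ∘ₗ extZ (k + 1) d, g.injective.comp (extZ_inj hk), fun q => ?_⟩
  unfold IsSimplexWithMap at hg
  rw [hg]
  constructor
  · rintro ⟨v, hv, hv0, rfl⟩
    obtain ⟨a, ha, rfl⟩ := (mem_simplexCone hk v).1 hv
    exact ⟨a, ha, by simpa using hv0, rfl⟩
  · rintro ⟨a, ha, h, rfl⟩
    exact ⟨extZ (k + 1) d a, (mem_simplexCone hk _).2 ⟨a, ha, rfl⟩, by simpa using h, rfl⟩

lemma exists_g {m : ℕ} (L : (Fin m → ℝ) →ₗ[ℝ] (Fin d → ℝ)) (hL : Function.Injective L) :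
    m ≤ d ∧ ∃ g : (Fin d → ℝ) ≃ₗ[ℝ] (Fin d → ℝ), ∀ a, g (extZ m d a) = L a := by
  have hm : m ≤ d := by
    have := LinearMap.finrank_le_finrank_of_injective hL
    simpa using this
  refine ⟨hm, ?_⟩
  have hw : LinearIndependent ℝ (fun i => L (Pi.basisFun ℝ (Fin m) i)) :=
    (Pi.basisFun ℝ (Fin m)).linearIndependent.map' L (LinearMap.ker_eq_bot.2 hL)
  let b := Module.Basis.sumExtend hw
  have : Finite (Fin m ⊕ Module.Basis.sumExtendIndex hw) := Module.Finite.finite_basis b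
  have hfJ : Finite (Module.Basis.sumExtendIndex hw) := Finite.of_injective _ (Sum.inr_injective (α := Fin m))
  have hcard : Nat.card (Module.Basis.sumExtendIndex hw) = d - m := by
    have h1 := Module.finrank_eq_nat_card_basis b
    rw [Nat.card_sum] at h1
    simp at h1
    rw [Nat.card_coe_set_eq]
    omega
  let eJ := Finite.equivFinOfCardEq hcard
  let e : Fin m ⊕ Module.Basis.sumExtendIndex hw ≃ Fin d :=
    ((Equiv.sumCongr (Equiv.refl _) eJ).trans finSumFinEquiv).trans (finCongr (by omega))
  let g := (Pi.basisFun ℝ (Fin d)).equiv b e.symm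
  refine ⟨g, fun a => ?_⟩
  have : g.toLinearMap ∘ₗ extZ m d = L := by
    refine (Pi.basisFun ℝ (Fin m)).ext fun i => ?_
    have h1 : extZ m d (Pi.basisFun ℝ (Fin m) i) = Pi.basisFun ℝ (Fin d) (e (Sum.inl i)) := by
      ext j
      by_cases hj : j.1 < m
      · simp [extZ, hj, e, Pi.single_apply, Fin.ext_iff]
      · have : j.1 ≠ i.1 := by omega
        simp [extZ, hj, e, Fin.ext_iff, this]
    rw [LinearMap.comp_apply, h1]
    show g _ = _
    rw [Module.Basis.equiv_apply, Equiv.symm_apply_apply]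
    simp only [b, Module.Basis.sumExtend, Module.Basis.reindex_apply, Module.Basis.extend_apply_self]
    rfl
  exact congrArg (fun l => l a) this

lemma spx_to {k : ℕ} {S : Set (PSpace d)} {L : (Fin (k + 1) → ℝ) →ₗ[ℝ] (Fin d → ℝ)}
    (hL : Function.Injective L) (h : IsSpx L S) : IsSimplexOfDim k S := by
  obtain ⟨hm, g, hg⟩ := exists_g L hL
  refine ⟨hm, g, ?_⟩
  unfold IsSimplexWithMap
  ext q
  rw [h q]
  constructor
  · rintro ⟨a, ha, h, rfl⟩
    refine ⟨extZ (k + 1) d a, (mem_simplexCone hm _).2 ⟨a, ha, rfl⟩, ?_, ?_⟩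
    · intro h0; rw [← hg, h0] at h; simp at h
    · simp only [hg]
  · rintro ⟨v, hv, hv0, rfl⟩
    obtain ⟨a, ha, rfl⟩ := (mem_simplexCone hm v).1 hv
    refine ⟨a, ha, ?_, ?_⟩
    · rw [← hg]; simpa using hv0
    · simp only [hg]

lemma spx_norm {k : ℕ} {S Ω : Set (PSpace d)} {f : (Fin d → ℝ) →ₗ[ℝ] ℝ}
    (hf : ∀ x ∈ closure Ω, f x.rep ≠ 0) (hS : S ⊆ Ω) (h : IsSimplexOfDim k S) :
    ∃ M : (Fin (k + 1) → ℝ) →ₗ[ℝ] (Fin d → ℝ), Function.Injective M ∧ IsSpx M S ∧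
      ∀ a, f (M a) = ∑ i, a i := by
  obtain ⟨L, hL, hLS⟩ := spx_of h
  have hL0 : ∀ a, a ≠ 0 → L a ≠ 0 := fun a ha h0 => ha (hL (by simpa using h0))
  have key : ∀ a : Fin (k + 1) → ℝ, (∀ i, 0 ≤ a i) → a ≠ 0 → f (L a) ≠ 0 := by
    intro a ha ha0
    refine cone_f_ne hf ?_
    have ht : Tendsto (fun t : ℝ => L (a + t • (fun _ => 1))) (𝓝[>] 0) (𝓝 (L a)) := by
      have : Continuous (fun t : ℝ => L (a + t • (fun _ => 1))) := by
        have hc : Continuous L := L.continuous_of_finiteDimensional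
        fun_prop
      have := (this.tendsto 0).mono_left (nhdsWithin_le_nhds (s := Ioi 0))
      simpa using this
    refine cone_closure ht ?_ (hL0 a ha0)
    filter_upwards [self_mem_nhdsWithin] with t ht
    have hp : ∀ i, 0 < (a + t • (fun _ => (1 : ℝ)) : Fin (k + 1) → ℝ) i := by
      intro i
      have := ha i
      have : 0 < t := ht
      simp; linarith
    have hne : L (a + t • (fun _ => (1 : ℝ))) ≠ 0 := hL0 _ fun h0 => by
      have := hp 0
      rw [h0] at this
      simp at this
    exact ⟨hne, hS ((hLS _).2 ⟨_, hp, hne, rfl⟩)⟩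
  let c : Fin (k + 1) → ℝ := fun i => f (L (Pi.single i 1))
  have hc : ∀ i, c i ≠ 0 := fun i => key _ (fun j => by
    by_cases h : j = i
    · subst h; simp
    · simp [h]) (by simp)
  have hLsum : ∀ a, f (L a) = ∑ i, a i * c i := by
    intro a
    conv_lhs => rw [pi_eq_sum_univ' a]
    simp [c, map_sum]
  have hsign : ∀ i j, 0 < c i → 0 < c j := by
    intro i j hi
    by_contra hj
    have hj' : c j < 0 := lt_of_le_of_ne (not_lt.1 hj) (hc j)
    have hij : i ≠ j := by rintro rfl; exact hj hi
    refine key (Pi.single i (-c j) + Pi.single j (c i)) (fun l => ?_) (fun h0 => ?_) ?_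
    · have h1 : 0 ≤ (Pi.single i (-c j) : Fin (k + 1) → ℝ) l := by
        by_cases h : l = i
        · subst h; simp [hj'.le]
        · simp [h]
      have h2 : 0 ≤ (Pi.single j (c i) : Fin (k + 1) → ℝ) l := by
        by_cases h : l = j
        · subst h; simp [hi.le]
        · simp [h]
      exact add_nonneg h1 h2
    · have := congrFun h0 j
      simp [hij.symm, hc i] at this
    · rw [hLsum]
      simp [add_mul, Finset.sum_add_distrib, Pi.single_apply, ite_mul]
      ring
  obtain ⟨σ, hσ0, hσ⟩ : ∃ σ : ℝ, σ ≠ 0 ∧ ∀ i, 0 < σ * c i := by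
    by_cases h0 : 0 < c 0
    · exact ⟨1, one_ne_zero, fun i => by simpa using hsign 0 i h0⟩
    · refine ⟨-1, by norm_num, fun i => ?_⟩
      have : ¬ 0 < c i := fun h => h0 (hsign i 0 h)
      have := lt_of_le_of_ne (not_lt.1 this) (hc i)
      linarith
  let N : (Fin (k + 1) → ℝ) →ₗ[ℝ] (Fin (k + 1) → ℝ) :=
    { toFun := fun a i => (c i)⁻¹ * a i
      map_add' := fun a b => by ext i; simp [mul_add]
      map_smul' := fun a b => by ext i; simp; ring }
  have hN : Function.Injective N := by
    intro a b hab
    ext i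
    have := congrFun hab i
    exact mul_left_cancel₀ (inv_ne_zero (hc i)) this
  refine ⟨L ∘ₗ N, hL.comp hN, fun q => ?_, fun a => ?_⟩
  · rw [hLS q]
    constructor
    · rintro ⟨a, ha, h, rfl⟩
      have e : (L ∘ₗ N) (fun i => (σ * c i) * a i) = σ • L a := by
        rw [← map_smul, LinearMap.comp_apply]
        congr 1
        ext i
        have := hc i
        simp [N]; field_simp
      refine ⟨fun i => (σ * c i) * a i, fun i => mul_pos (hσ i) (ha i), ?_, ?_⟩
      · rw [e]; exact smul_ne_zero hσ0 h
      · symm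
        rw [Projectivization.mk_eq_mk_iff']
        exact ⟨σ, e.symm⟩
    · rintro ⟨a, ha, h, rfl⟩
      have e : L (fun i => (σ * c i)⁻¹ * a i) = σ⁻¹ • (L ∘ₗ N) a := by
        rw [LinearMap.comp_apply, ← map_smul]
        congr 1
        ext i
        have := hc i
        simp [N]; field_simp
      refine ⟨fun i => (σ * c i)⁻¹ * a i, fun i => mul_pos (inv_pos.2 (hσ i)) (ha i), ?_, ?_⟩
      · rw [e]; exact smul_ne_zero (inv_ne_zero hσ0) h
      · symm
        rw [Projectivization.mk_eq_mk_iff']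
        exact ⟨σ⁻¹, e.symm⟩
  · rw [LinearMap.comp_apply, hLsum]
    refine Finset.sum_congr rfl fun i _ => ?_
    have := hc i
    simp [N]; field_simp

lemma spx_chart {k : ℕ} {S Ω : Set (PSpace d)} {f : (Fin d → ℝ) →ₗ[ℝ] ℝ}
    (hf : ∀ x ∈ closure Ω, f x.rep ≠ 0) (hS : S ⊆ Ω) (h : IsSimplexOfDim k S)
    (hpe : IsProperlyEmbedded S Ω) :
    ∃ w : Fin (k + 1) → (Fin d → ℝ), (∀ i, f (w i) = 1) ∧
      (∀ a ∈ stdSimplex ℝ (Fin (k + 1)), ∑ i, a i • w i ∈ closure (chartMap f '' Ω)) ∧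
      (∀ x ∈ S, ∃ a ∈ stdSimplex ℝ (Fin (k + 1)), chartMap f x = ∑ i, a i • w i) ∧
      (∀ a ∈ stdSimplex ℝ (Fin (k + 1)), ∑ i, a i • w i ∈ chartMap f '' Ω →
        (∀ i, 0 < a i) ∧ ∑ i, a i • w i ∈ cone S) := by
  obtain ⟨M, hM, hMS, hfM⟩ := spx_norm hf hS h
  have hf' : ∀ x ∈ Ω, f x.rep ≠ 0 := fun x hx => hf x (subset_closure hx)
  have hMa : ∀ a : Fin (k + 1) → ℝ, M a = ∑ i, a i • M (Pi.single i 1) := by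
    intro a
    conv_lhs => rw [pi_eq_sum_univ' a]
    simp [map_sum]
  have hpos : ∀ a : Fin (k + 1) → ℝ, (∀ i, 0 < a i) → M a ∈ cone S := by
    intro a ha
    have : M a ≠ 0 := by
      intro h0
      have h1 := hfM a
      rw [h0, map_zero] at h1
      have : 0 < ∑ i, a i := Finset.sum_pos (fun i _ => ha i) ⟨0, Finset.mem_univ _⟩
      linarith
    exact ⟨this, (hMS _).2 ⟨a, ha, this, rfl⟩⟩
  have hcl : closure S ∩ Ω ⊆ S := by
    obtain ⟨hi, hp⟩ := hpe
    have hr : IsClosed (range (Set.inclusion hi)) := hp.isClosedMap.isClosed_range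
    rintro x ⟨hx, hxΩ⟩
    have : (⟨x, hxΩ⟩ : Ω) ∈ closure (range (Set.inclusion hi)) := by
      rw [closure_subtype]
      convert hx
      ext y
      constructor
      · rintro ⟨_, ⟨z, rfl⟩, rfl⟩; exact z.2
      · intro hy; exact ⟨_, ⟨⟨y, hy⟩, rfl⟩, rfl⟩
    rw [hr.closure_eq] at this
    obtain ⟨z, hz⟩ := this
    have := congrArg Subtype.val hz
    simp at this
    rw [← this]; exact z.2
  -- approximations
  have happ : ∀ a ∈ stdSimplex ℝ (Fin (k + 1)),
      Tendsto (fun t : ℝ => M ((1 - t) • a + t • (fun _ => ((k : ℝ) + 1)⁻¹))) (𝓝[>] 0) (𝓝 (M a)) ∧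
      ∀ᶠ t in 𝓝[>] (0 : ℝ), M ((1 - t) • a + t • (fun _ => ((k : ℝ) + 1)⁻¹)) ∈ cone S ∧
        f (M ((1 - t) • a + t • (fun _ => ((k : ℝ) + 1)⁻¹))) = 1 := by
    rintro a ⟨ha, hs⟩
    constructor
    · have : Continuous (fun t : ℝ => M ((1 - t) • a + t • (fun _ => ((k : ℝ) + 1)⁻¹))) := by
        have hc : Continuous M := M.continuous_of_finiteDimensional
        fun_prop
      have := (this.tendsto 0).mono_left (nhdsWithin_le_nhds (s := Ioi 0))
      simpa using this
    · filter_upwards [Ioo_mem_nhdsGT (zero_lt_one' ℝ)] with t ht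
      have hk : (0 : ℝ) < (k : ℝ) + 1 := by positivity
      refine ⟨hpos _ fun i => ?_, ?_⟩
      · have h1 := mul_nonneg (sub_nonneg.2 ht.2.le) (ha i)
        have h2 := mul_pos ht.1 (inv_pos.2 hk)
        simp only [Pi.add_apply, Pi.smul_apply, smul_eq_mul]
        linarith
      · rw [hfM]
        simp only [Pi.add_apply, Pi.smul_apply, smul_eq_mul, Finset.sum_add_distrib,
          ← Finset.mul_sum, hs]
        simp
        field_simp
        ring
  refine ⟨fun i => M (Pi.single i 1), fun i => ?_, fun a ha => ?_, fun x hx => ?_, fun a ha hO => ?_⟩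
  · rw [hfM]; simp
  · rw [← hMa]
    refine mem_closure_of_tendsto (happ a ha).1 ?_
    filter_upwards [(happ a ha).2] with t ht
    obtain ⟨⟨h0, h1⟩, h2⟩ := ht
    exact (chart_mem hf').2 ⟨h2, h0, hS h1⟩
  · obtain ⟨a, ha, h, rfl⟩ := (hMS x).1 hx
    have hsp : 0 < ∑ i, a i := Finset.sum_pos (fun i _ => ha i) ⟨0, Finset.mem_univ _⟩
    refine ⟨(∑ i, a i)⁻¹ • a, ⟨fun i => ?_, ?_⟩, ?_⟩
    · exact mul_nonneg (inv_nonneg.2 hsp.le) (ha i).le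
    · simp only [Pi.smul_apply, smul_eq_mul, ← Finset.mul_sum]
      exact inv_mul_cancel₀ hsp.ne'
    · rw [← hMa, mk_chart h (by rw [hfM]; exact hsp.ne'), map_smul, hfM]
  · rw [← hMa] at hO ⊢
    obtain ⟨h1, h0, h2⟩ := (chart_mem hf').1 hO
    obtain ⟨h0', h3⟩ := cone_closure (happ a ha).1 ((happ a ha).2.mono fun t ht => ht.1) h0
    have hSa := hcl ⟨h3, h2⟩
    refine ⟨?_, h0, hSa⟩
    obtain ⟨b, hb, hb0, hab⟩ := (hMS _).1 hSa
    have hsp : 0 < ∑ i, b i := Finset.sum_pos (fun i _ => hb i) ⟨0, Finset.mem_univ _⟩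
    have e := congrArg (chartMap f) hab
    rw [mk_chart _ (by rw [h1]; exact one_ne_zero), mk_chart _ (by rw [hfM]; exact hsp.ne'), h1, hfM,
      inv_one, one_smul, ← map_smul] at e
    rw [hM e]
    exact fun i => mul_pos (inv_pos.2 hsp) (hb i)

lemma ultra_lim {X : Type*} [TopologicalSpace X] {K : Set X} (hK : IsCompact K) (U : Ultrafilter ℕ)
    {s : ℕ → X} (h : ∀ᶠ n in (U : Filter ℕ), s n ∈ K) : ∃ x ∈ K, Tendsto s U (𝓝 x) := by
  obtain ⟨x, hx, hl⟩ := hK.ultrafilter_le_nhds (U.map s) (by rw [le_principal_iff]; exact h)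
  exact ⟨x, hx, hl⟩

lemma eps_lemma {D ε : ℝ} (hD : 0 < D) (hε : 0 < ε) :
    ∃ ε' > 0, ∀ h < ε', D * (Real.exp (2 * h) - 1) < ε := by
  have h1 : 0 < ε / D := by positivity
  refine ⟨Real.log (1 + ε / D) / 2, by have := Real.log_pos (show 1 < 1 + ε / D by linarith); linarith,
    fun h hh => ?_⟩
  have : Real.exp (2 * h) < 1 + ε / D := by
    rw [← Real.lt_log_iff_exp_lt (by linarith)]; linarith
  have e : D * (ε / D) = ε := by field_simp
  nlinarith

lemma inj_of_pos {k : ℕ} {f : (Fin d → ℝ) →ₗ[ℝ] ℝ} {O : Set (Fin d → ℝ)}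
    {W : Fin (k + 1) → Fin d → ℝ} (hW : ∀ i, f (W i) = 1)
    (hF2 : ∀ a ∈ stdSimplex ℝ (Fin (k + 1)), ∑ i, a i • W i ∈ O → ∀ i, 0 < a i)
    {a : Fin (k + 1) → ℝ} (ha : a ∈ stdSimplex ℝ (Fin (k + 1))) (haO : ∑ i, a i • W i ∈ O) :
    Function.Injective (Fintype.linearCombination ℝ W) := by
  rw [← LinearMap.ker_eq_bot, LinearMap.ker_eq_bot']
  intro c hc
  rw [Fintype.linearCombination_apply] at hc
  by_contra hne
  have hs : ∑ i, c i = 0 := by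
    have := congrArg f hc
    simpa [map_sum, hW] using this
  have hneg : ∃ i, c i < 0 := by
    by_contra! hn
    apply hne
    ext i
    exact (Finset.sum_eq_zero_iff_of_nonneg fun i _ => hn i).1 hs i (Finset.mem_univ _)
  obtain ⟨j, hj⟩ := hneg
  obtain ⟨i, hi, hmin⟩ := (Finset.univ.filter fun i => c i < 0).exists_min_image
    (fun i => a i / (-c i)) ⟨j, by simpa using hj⟩
  simp only [Finset.mem_filter, Finset.mem_univ, true_and] at hi hmin
  have hpa := hF2 a ha haO
  have ht : 0 < a i / (-c i) := div_pos (hpa i) (by linarith)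
  have hmem : (fun l => a l + a i / (-c i) * c l) ∈ stdSimplex ℝ (Fin (k + 1)) := by
    refine ⟨fun l => ?_, ?_⟩
    · by_cases hl : c l < 0
      · have := hmin l hl
        rw [le_div_iff₀ (by linarith)] at this
        show 0 ≤ a l + a i / (-c i) * c l
        linarith
      · have := mul_nonneg ht.le (not_lt.1 hl)
        have := (hpa l).le
        show 0 ≤ a l + a i / (-c i) * c l
        linarith
    · rw [Finset.sum_add_distrib, ← Finset.mul_sum, hs, ha.2]; simp
  have := hF2 _ hmem (by
    convert haO using 1
    simp only [add_smul, mul_smul, Finset.sum_add_distrib, ← Finset.smul_sum, hc]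
    simp) i
  have e : a i / (-c i) * c i = - a i := by
    have := hi.ne
    field_simp
  simp only [e] at this
  linarith

lemma pe_of_closed_s4 {C Ω : Set (PSpace d)} (hCsub : C ⊆ Ω) (hCcl : closure C ∩ Ω ⊆ C) :
    IsProperlyEmbedded C Ω := by
  refine ⟨hCsub, Topology.IsClosedEmbedding.isProperMap ⟨Topology.IsEmbedding.inclusion hCsub, ?_⟩⟩
  have : range (Set.inclusion hCsub) = (Subtype.val : Ω → PSpace d) ⁻¹' closure C := by
    ext x
    rw [Set.range_inclusion]
    exact ⟨fun h => subset_closure h, fun h => hCcl ⟨h, x.2⟩⟩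
  rw [this]
  exact isClosed_closure.preimage continuous_subtype_val

lemma limit_spx {Ω C : Set (PSpace d)} {f : (Fin d → ℝ) →ₗ[ℝ] ℝ} {k : ℕ}
    (hf : ∀ x ∈ Ω, f x.rep ≠ 0) (hO : RelOpen f (chartMap f '' Ω))
    (hcv : Convex ℝ (chartMap f '' Ω)) (hCne : C.Nonempty) (hCsub : C ⊆ Ω)
    {W : Fin (k + 1) → Fin d → ℝ} (hW : ∀ i, f (W i) = 1)
    (hWc : ∀ i, W i ∈ closure (chartMap f '' Ω))
    (F1 : ∀ x ∈ C, ∃ a ∈ stdSimplex ℝ (Fin (k + 1)), chartMap f x = ∑ i, a i • W i)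
    (F2 : ∀ a ∈ stdSimplex ℝ (Fin (k + 1)), ∑ i, a i • W i ∈ chartMap f '' Ω →
        (∀ i, 0 < a i) ∧ ∑ i, a i • W i ∈ cone C) : IsSimplexOfDim k C := by
  obtain ⟨x, hx⟩ := hCne
  obtain ⟨a, ha, hxa⟩ := F1 x hx
  have haO : ∑ i, a i • W i ∈ chartMap f '' Ω := ⟨x, hCsub hx, hxa⟩
  have F3 : ∀ b ∈ stdSimplex ℝ (Fin (k + 1)), (∀ i, 0 < b i) → ∑ i, b i • W i ∈ chartMap f '' Ω := by
    intro b hb hbp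
    obtain ⟨j, hj⟩ := Finite.exists_min b
    have hle : ∀ c ∈ stdSimplex ℝ (Fin (k + 1)), ∀ i, c i ≤ 1 := by
      intro c hc i
      rw [← hc.2]
      exact Finset.single_le_sum (fun i _ => hc.1 i) (Finset.mem_univ i)
    have hbj := hle b hb j
    have hbj0 := hbp j
    have ht : 0 < 1 - b j / 2 := by linarith
    let c : Fin (k + 1) → ℝ := fun i => (1 - b j / 2)⁻¹ * (b i - b j / 2 * a i)
    have hz : ∑ i, c i • W i ∈ closure (chartMap f '' Ω) := by
      refine hcv.closure.sum_mem (fun i _ => ?_) ?_ (fun i _ => hWc i)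
      · refine mul_nonneg (inv_nonneg.2 ht.le) ?_
        have h1 := hle a ha i
        have h2 := hj i
        have h3 := ha.1 i
        nlinarith
      · simp only [c, ← Finset.mul_sum, Finset.sum_sub_distrib, ha.2, hb.2, mul_one]
        exact inv_mul_cancel₀ ht.ne'
    have hfz : f (∑ i, c i • W i) = 1 := by
      simp only [map_sum, map_smul, hW, smul_eq_mul, mul_one]
      simp only [c, ← Finset.mul_sum, Finset.sum_sub_distrib, ha.2, hb.2, mul_one]
      exact inv_mul_cancel₀ ht.ne'
    have := convex_push hO hcv haO hz hfz ht.le (by linarith)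
    convert this using 1
    simp only [Finset.smul_sum, ← Finset.sum_add_distrib, smul_smul, ← add_smul]
    refine Finset.sum_congr rfl fun i _ => ?_
    congr 1
    simp only [c]
    rw [mul_inv_cancel_left₀ ht.ne']
    ring
  have hinj := inj_of_pos hW (fun a ha h => (F2 a ha h).1) ha haO
  refine spx_to hinj fun q => ⟨fun hq => ?_, ?_⟩
  · obtain ⟨b, hb, hqb⟩ := F1 q hq
    have hbO : ∑ i, b i • W i ∈ chartMap f '' Ω := ⟨q, hCsub hq, hqb⟩
    have h0 : ∑ i, b i • W i ≠ 0 := ((chart_mem hf).1 hbO).2.1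
    refine ⟨b, (F2 b hb hbO).1, by rwa [Fintype.linearCombination_apply], ?_⟩
    simp only [Fintype.linearCombination_apply, ← hqb]
    refine (Projectivization.mk_rep q).symm.trans ?_
    rw [Projectivization.mk_eq_mk_iff']
    refine ⟨f q.rep, ?_⟩
    have := hf q (hCsub hq)
    simp only [chartMap, smul_smul]
    rw [mul_inv_cancel₀ this, one_smul]
  · rintro ⟨b, hb, h0, rfl⟩
    have hsp : 0 < ∑ i, b i := Finset.sum_pos (fun i _ => hb i) ⟨0, Finset.mem_univ _⟩
    have hmem : (∑ i, b i)⁻¹ • b ∈ stdSimplex ℝ (Fin (k + 1)) := by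
      refine ⟨fun i => mul_nonneg (inv_nonneg.2 hsp.le) (hb i).le, ?_⟩
      simp only [Pi.smul_apply, smul_eq_mul, ← Finset.mul_sum]
      exact inv_mul_cancel₀ hsp.ne'
    have := (F2 _ hmem (F3 _ hmem fun i => mul_pos (inv_pos.2 hsp) (hb i))).2
    have h2 := cone_smul hsp.ne' this
    rw [← Fintype.linearCombination_apply, ← map_smul, smul_smul, mul_inv_cancel₀ hsp.ne',
      one_smul] at h2
    exact h2.2

theorem main_aux_s4 (Ω : Set (PSpace d)) (hΩ : IsPCDomain Ω)
    (F : ℕ → Set (PSpace d))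
    (hF : ∀ n, ∃ k : ℕ, 2 ≤ k ∧ IsSimplexOfDim k (F n) ∧ F n ⊆ Ω ∧
      IsProperlyEmbedded (F n) Ω)
    (C : Set (PSpace d)) (hCne : C.Nonempty) (hCsub : C ⊆ Ω) (hCcl : closure C ∩ Ω ⊆ C)
    (hconv : LocalHausConv Ω F C) :
    ∃ k : ℕ, 2 ≤ k ∧ IsSimplexOfDim k C ∧ IsProperlyEmbedded C Ω := by
  obtain ⟨hop, -, hpc⟩ := hΩ
  obtain ⟨f, hfe⟩ : ∃ f, f = chartOf Ω := ⟨_, rfl⟩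
  obtain ⟨hfcl, hcv, hbd⟩ : (∀ x ∈ closure Ω, f x.rep ≠ 0) ∧
      Convex ℝ (chartMap f '' Ω) ∧ Bornology.IsBounded (chartMap f '' Ω) := by
    rw [hfe, chartOf, dif_pos hpc]
    exact hpc.choose_spec
  have hdist : ∀ x y, hilbertDist Ω x y =
      hilbertDistChart (chartMap f '' Ω) (chartMap f x) (chartMap f y) := by
    intro x y; rw [hfe]; rfl
  have hf : ∀ x ∈ Ω, f x.rep ≠ 0 := fun x hx => hfcl x (subset_closure hx)
  have hO : RelOpen f (chartMap f '' Ω) := by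
    refine ⟨fun v hv => ((chart_mem hf).1 hv).1, fun v hv => ?_⟩
    obtain ⟨ρ, hρ, h⟩ := Metric.isOpen_iff.1 (cone_open hop) v ((chart_mem hf).1 hv).2
    refine ⟨ρ, hρ, fun z hz hzv => (chart_mem hf).2 ⟨hz, h ?_⟩⟩
    rwa [Metric.mem_ball, dist_eq_norm]
  obtain ⟨D, hD0, hD⟩ : ∃ D > 0, ∀ p ∈ chartMap f '' Ω, ∀ q ∈ chartMap f '' Ω, ‖p - q‖ ≤ D := by
    obtain ⟨D, hD⟩ := Metric.isBounded_iff.1 hbd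
    refine ⟨max D 1, by positivity, fun p hp q hq => ?_⟩
    rw [← dist_eq_norm]
    exact le_trans (hD hp hq) (le_max_left _ _)
  choose kk hk2 hkS hsub hpe using hF
  let U : Ultrafilter ℕ := hyperfilter ℕ
  have hU : (U : Filter ℕ) ≤ atTop := Nat.hyperfilter_le_atTop
  obtain ⟨k, hk⟩ : ∃ k, ∀ᶠ n in (U : Filter ℕ), kk n = k := by
    obtain ⟨k, -, hk⟩ := Ultrafilter.eq_pure_of_finite_mem (f := U.map kk) (Set.finite_Iic d) (by
        refine Ultrafilter.mem_map.2 (Filter.univ_mem' fun n => ?_)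
        have := (hkS n).1
        show kk n ≤ d
        omega)
    refine ⟨k, ?_⟩
    have : {k} ∈ U.map kk := by rw [hk]; exact rfl
    exact this
  have hk2' : 2 ≤ k := by
    obtain ⟨n, hn⟩ := hk.exists
    exact hn ▸ hk2 n
  have hex : ∀ n, ∃ w : Fin (k + 1) → (Fin d → ℝ), kk n = k → (∀ i, f (w i) = 1) ∧
      (∀ a ∈ stdSimplex ℝ (Fin (k + 1)), ∑ i, a i • w i ∈ closure (chartMap f '' Ω)) ∧
      (∀ x ∈ F n, ∃ a ∈ stdSimplex ℝ (Fin (k + 1)), chartMap f x = ∑ i, a i • w i) ∧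
      (∀ a ∈ stdSimplex ℝ (Fin (k + 1)), ∑ i, a i • w i ∈ chartMap f '' Ω →
        (∀ i, 0 < a i) ∧ ∑ i, a i • w i ∈ cone (F n)) := by
    intro n
    by_cases hn : kk n = k
    · obtain ⟨w, hw⟩ := spx_chart hfcl (hsub n) (hn ▸ hkS n) (hpe n)
      exact ⟨w, fun _ => hw⟩
    · exact ⟨0, fun h => absurd h hn⟩
  choose w hw using hex
  have hw' := hk.mono fun n hn => hw n hn
  have hlim : ∀ i, ∃ x ∈ closure (chartMap f '' Ω), Tendsto (fun n => w n i) U (𝓝 x) := by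
    intro i
    refine ultra_lim hbd.isCompact_closure U (hw'.mono fun n hn => ?_)
    have := hn.2.1 (Pi.single i 1) (single_mem_stdSimplex ℝ i)
    simpa [Pi.single_apply, ite_smul] using this
  choose W hWc hWl using hlim
  have hfc : Continuous f := f.continuous_of_finiteDimensional
  have hW : ∀ i, f (W i) = 1 := by
    intro i
    refine tendsto_nhds_unique ((hfc.tendsto _).comp (hWl i)) ?_
    refine tendsto_const_nhds.congr' ?_
    filter_upwards [hw'] with n hn
    exact (hn.1 i).symm
  have hsumf : ∀ (w : Fin (k + 1) → Fin d → ℝ), (∀ i, f (w i) = 1) →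
      ∀ a ∈ stdSimplex ℝ (Fin (k + 1)), f (∑ i, a i • w i) = 1 := by
    intro w hw a ha
    simp [map_sum, hw, ha.2]
  refine ⟨k, hk2', limit_spx hf hO hcv hCne hCsub hW hWc ?_ ?_, pe_of_closed_s4 hCsub hCcl⟩
  · intro x hx
    have hcl : IsClosed ((fun a : Fin (k + 1) → ℝ => ∑ i, a i • W i) '' stdSimplex ℝ (Fin (k + 1))) :=
      ((isCompact_stdSimplex ℝ (Fin (k + 1))).image (by fun_prop)).isClosed
    suffices h : chartMap f x ∈
        (fun a : Fin (k + 1) → ℝ => ∑ i, a i • W i) '' stdSimplex ℝ (Fin (k + 1)) by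
      obtain ⟨a, ha, h⟩ := h
      exact ⟨a, ha, h.symm⟩
    rw [← hcl.closure_eq, Metric.mem_closure_iff]
    intro ε hε
    obtain ⟨ε', hε', hh⟩ := eps_lemma hD0 (half_pos hε)
    have h1 := hU (hconv x (hCsub hx) 1 one_pos ε' hε')
    have h2 : ∀ᶠ n in (U : Filter ℕ), ∀ i, dist (w n i) (W i) < ε / 2 :=
      eventually_all.2 fun i => (Metric.tendsto_nhds.1 (hWl i)) _ (half_pos hε)
    obtain ⟨n, ⟨h1, h2⟩, h3⟩ := ((Filter.Eventually.and h1 h2).and hw').exists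
    obtain ⟨y, ⟨hy, -⟩, hyx⟩ := h1.2 x ⟨hx, hCsub hx, by rw [hdist]; simp [hilbertDistChart]⟩
    obtain ⟨a, ha, hya⟩ := h3.2.2.1 y hy
    refine ⟨_, ⟨a, ha, rfl⟩, ?_⟩
    have e1 : ‖chartMap f x - chartMap f y‖ < ε / 2 := by
      refine lt_of_le_of_lt (hilbert_lower hO hD hD0 ⟨y, hsub n hy, rfl⟩ ⟨x, hCsub hx, rfl⟩) ?_
      rw [← hdist]
      exact hh _ hyx
    have e2 : ‖∑ i, a i • w n i - ∑ i, a i • W i‖ ≤ ε / 2 := by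
      rw [← Finset.sum_sub_distrib]
      calc _ ≤ ∑ i, ‖a i • w n i - a i • W i‖ := norm_sum_le _ _
        _ ≤ ∑ i, a i * (ε / 2) := by
          refine Finset.sum_le_sum fun i _ => ?_
          rw [← smul_sub, norm_smul, Real.norm_eq_abs, abs_of_nonneg (ha.1 i), ← dist_eq_norm]
          exact mul_le_mul_of_nonneg_left (h2 i).le (ha.1 i)
        _ = ε / 2 := by rw [← Finset.sum_mul, ha.2, one_mul]
    rw [dist_eq_norm]
    calc ‖chartMap f x - ∑ i, a i • W i‖ =
        ‖(chartMap f x - chartMap f y) + (∑ i, a i • w n i - ∑ i, a i • W i)‖ := by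
          rw [hya]; congr 1; abel
      _ ≤ _ := norm_add_le _ _
      _ < ε := by linarith
  · intro a ha hz
    have hst : Tendsto (fun n => ∑ i, a i • w n i) U (𝓝 (∑ i, a i • W i)) :=
      tendsto_finsetSum _ fun i _ => (hWl i).const_smul (a i)
    have hzc := (chart_mem hf).1 hz
    have hev : ∀ᶠ n in (U : Filter ℕ), ∑ i, a i • w n i ∈ chartMap f '' Ω := by
      filter_upwards [hst ((cone_open hop).mem_nhds hzc.2), hw'] with n h1 h2
      exact (chart_mem hf).2 ⟨hsumf _ h2.1 a ha, h1⟩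
    have hev2 := (hev.and hw').mono fun n hn => hn.2.2.2.2 a ha hn.1
    refine ⟨?_, ?_⟩
    · obtain ⟨n, hn⟩ := hev2.exists
      exact hn.1
    obtain ⟨h0, hzΩ⟩ := hzc.2
    have hzchart : chartMap f (Projectivization.mk ℝ (∑ i, a i • W i) h0) = ∑ i, a i • W i := by
      rw [mk_chart h0 (by rw [hzc.1]; exact one_ne_zero), hzc.1]; simp
    have hcl : ∑ i, a i • W i ∈ closure (chartMap f '' C) := by
      rw [Metric.mem_closure_iff]
      intro ε hε
      obtain ⟨ε', hε', hh⟩ := eps_lemma hD0 (half_pos hε)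
      obtain ⟨δ, hδ, hup⟩ := hilbert_upper hO hD hz
      have h1 := hU (hconv _ hzΩ 2 two_pos ε' hε')
      obtain ⟨n, ⟨⟨⟨h1, h2⟩, h3⟩, h4⟩, h5⟩ := ((((Filter.Eventually.and h1
        (Metric.tendsto_nhds.1 hst _ (half_pos hε))).and
        (Metric.tendsto_nhds.1 hst _ hδ)).and hev).and hev2).exists
      obtain ⟨-, hs0, hsF⟩ := h5
      have hschart : chartMap f (Projectivization.mk ℝ (∑ i, a i • w n i) hs0) =
          ∑ i, a i • w n i := by
        have := ((chart_mem hf).1 h4).1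
        rw [mk_chart hs0 (by rw [this]; exact one_ne_zero), this]; simp
      obtain ⟨c, ⟨hc, -⟩, hcd⟩ := h1.1 _ ⟨hsF, hsub n hsF, by
        rw [hdist, hzchart, hschart]
        exact hup _ h4 (by rwa [← dist_eq_norm])⟩
      refine ⟨_, ⟨c, hc, rfl⟩, ?_⟩
      have e1 := hilbert_lower hO hD hD0 h4 ⟨c, hCsub hc, rfl⟩
      rw [hdist, hschart] at hcd
      have e2 := hh _ hcd
      rw [← dist_eq_norm] at e1
      calc dist (∑ i, a i • W i) (chartMap f c) ≤ dist (∑ i, a i • W i) (∑ i, a i • w n i) +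
            dist (∑ i, a i • w n i) (chartMap f c) := dist_triangle _ _ _
        _ < ε := by rw [dist_comm, dist_comm _ (chartMap f c)]; linarith
    have : (𝓝[chartMap f '' C] (∑ i, a i • W i)).NeBot := mem_closure_iff_nhdsWithin_neBot.1 hcl
    obtain ⟨h0', hcc⟩ := cone_closure (A := C) (s := id) (l := 𝓝[chartMap f '' C] (∑ i, a i • W i))
      nhdsWithin_le_nhds (by
        filter_upwards [self_mem_nhdsWithin] with v hv
        exact ((chart_mem fun x hx => hf x (hCsub hx)).1 hv).2) h0
    exact ⟨h0, hCcl ⟨hcc, hzΩ⟩⟩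

/-- Proposition 2.11: the collection of properly embedded simplices in `Ω` of
dimension at least two is closed in the local Hausdorff topology induced by `d_Ω`. -/
theorem properly_embedded_simplices_closed {d : ℕ} (Ω : Set (PSpace d)) (hΩ : IsPCDomain Ω)
    (F : ℕ → Set (PSpace d))
    (hF : ∀ n, ∃ k : ℕ, 2 ≤ k ∧ IsSimplexOfDim k (F n) ∧ F n ⊆ Ω ∧
      IsProperlyEmbedded (F n) Ω)
    (C : Set (PSpace d)) (hCne : C.Nonempty) (hCsub : C ⊆ Ω) (hCcl : closure C ∩ Ω ⊆ C)
    (hconv : LocalHausConv Ω F C) :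
    ∃ k : ℕ, 2 ≤ k ∧ IsSimplexOfDim k C ∧ IsProperlyEmbedded C Ω := by
  exact main_aux_s4 Ω hΩ F hF C hCne hCsub hCcl hconv

end Paper
end
end
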